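/- Let p ≥ 2 be an integer and let μ be a Borel probability measure on the circle 𝕋 = ℝ/ℤ which is invariant and ergodic under T_p and satisfies dim μ > 0. Let m > p be an integer with m ≁ p. Then for μ-almost every x, the sequence (1/N)∑_{i=0}^{N-1} δ_{(T_m^i x, T_p^i x)} converges in the weak-* topology to λ × μ on 𝕋². -/

import Mathlib

open MeasureTheory Filter Set Topology
open scoped ENNReal

/-- The (lower) Hausdorff dimension of a measure:
`dim μ = inf { dim_H A : A Borel, μ(A) > 0 }`. -/
noncomputable def measureDim {X : Type*} [EMetricSpace X] [MeasurableSpace X]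
    (μ : Measure X) : ℝ≥0∞ :=
  ⨅ (A : Set X) (_ : MeasurableSet A) (_ : 0 < μ A), dimH A

set_option linter.unusedVariables false
set_option linter.unusedSectionVars false

namespace SEq

section Maximal
variable {X : Type*} [MeasurableSpace X]

/-- running maximum of Birkhoff sums -/
noncomputable def maxSum (R : X → X) (f : X → ℝ) : ℕ → X → ℝ
  | 0, _ => 0
  | n + 1, x => max 0 (f x + maxSum R f n (R x))

lemma maxSum_nonneg (R : X → X) (f : X → ℝ) (n : ℕ) (x : X) : 0 ≤ maxSum R f n x := by
  cases n with
  | zero => exact le_rfl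
  | succ n => exact le_max_left _ _

lemma maxSum_mono (R : X → X) (f : X → ℝ) (n : ℕ) :
    ∀ x, maxSum R f n x ≤ maxSum R f (n + 1) x := by
  induction n with
  | zero => intro x; exact maxSum_nonneg R f 1 x
  | succ n ih =>
    intro x
    have := ih (R x)
    change max 0 (f x + maxSum R f n (R x)) ≤ max 0 (f x + maxSum R f (n + 1) (R x))
    gcongr

lemma birkhoffSum_le_maxSum (R : X → X) (f : X → ℝ) (n : ℕ) :
    ∀ x, birkhoffSum R f n x ≤ maxSum R f n x := by
  induction n with
  | zero => intro x; simp [maxSum]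
  | succ n ih =>
    intro x
    rw [birkhoffSum_succ']
    exact (add_le_add le_rfl (ih (R x))).trans (le_max_right _ _)

lemma exists_birkhoffSum_pos (R : X → X) (f : X → ℝ) (n : ℕ) :
    ∀ x, ∃ k, maxSum R f n x = birkhoffSum R f k x := by
  induction n with
  | zero => intro x; exact ⟨0, by simp [maxSum]⟩
  | succ n ih =>
    intro x
    obtain ⟨k, hk⟩ := ih (R x)
    rcases le_total 0 (f x + maxSum R f n (R x)) with h | h
    · refine ⟨k + 1, ?_⟩
      change max 0 (f x + maxSum R f n (R x)) = _
      rw [max_eq_right h, birkhoffSum_succ', hk]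
    · refine ⟨0, ?_⟩
      change max 0 (f x + maxSum R f n (R x)) = _
      rw [max_eq_left h]; simp

variable {μ : Measure X} [IsFiniteMeasure μ] {R : X → X} {f : X → ℝ}

lemma maxSum_measurable (hR : Measurable R) (hf : Measurable f) (n : ℕ) :
    Measurable (maxSum R f n) := by
  induction n with
  | zero => exact measurable_const
  | succ n ih => exact measurable_const.max (hf.add (ih.comp hR))

lemma maxSum_integrable (hR : MeasurePreserving R μ μ) (hf : Integrable f μ) (n : ℕ) :
    Integrable (maxSum R f n) μ := by
  induction n with
  | zero => exact integrable_const _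
  | succ n ih =>
    exact (integrable_const (0:ℝ)).sup (hf.add (hR.integrable_comp_of_integrable ih))

lemma garsia (hR : MeasurePreserving R μ μ) (hfm : Measurable f) (hf : Integrable f μ) (n : ℕ) :
    0 ≤ ∫ x in {x | 0 < maxSum R f n x}, f x ∂μ := by
  have hm := maxSum_measurable hR.measurable hfm n
  have hi := maxSum_integrable hR hf n
  have hiR : Integrable (fun x => maxSum R f n (R x)) μ := hR.integrable_comp_of_integrable hi
  have hE : MeasurableSet {x | 0 < maxSum R f n x} := measurableSet_lt measurable_const hm
  have h1 : ∫ x in {x | 0 < maxSum R f n x}, (maxSum R f n x - maxSum R f n (R x)) ∂μ ≤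
      ∫ x in {x | 0 < maxSum R f n x}, f x ∂μ := by
    refine setIntegral_mono_on (hi.sub hiR).integrableOn hf.integrableOn hE ?_
    intro x hx
    cases n with
    | zero => exact absurd hx (by simp [maxSum])
    | succ n =>
      have h2 : maxSum R f (n+1) x = f x + maxSum R f n (R x) := by
        change max 0 (f x + maxSum R f n (R x)) = _
        rcases le_total 0 (f x + maxSum R f n (R x)) with h | h
        · exact max_eq_right h
        · have hx' : 0 < max 0 (f x + maxSum R f n (R x)) := hx
          rw [max_eq_left h] at hx'
          exact absurd hx' (lt_irrefl _)
      have := maxSum_mono R f n (R x)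
      linarith
  refine le_trans ?_ h1
  rw [integral_sub hi.integrableOn hiR.integrableOn]
  have h3 : ∫ x in {x | 0 < maxSum R f n x}, maxSum R f n x ∂μ = ∫ x, maxSum R f n x ∂μ := by
    apply setIntegral_eq_integral_of_forall_compl_eq_zero
    intro x hx
    exact le_antisymm (not_lt.1 hx) (maxSum_nonneg _ _ _ _)
  have h4 : ∫ x in {x | 0 < maxSum R f n x}, maxSum R f n (R x) ∂μ ≤
      ∫ x, maxSum R f n (R x) ∂μ :=
    setIntegral_le_integral hiR (Eventually.of_forall fun x => maxSum_nonneg _ _ _ _)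
  have h5 : ∫ x, maxSum R f n (R x) ∂μ = ∫ x, maxSum R f n x ∂μ := by
    rw [← integral_map hR.measurable.aemeasurable (by rw [hR.map_eq]; exact hi.1), hR.map_eq]
  linarith

lemma maximal_ergodic (hR : MeasurePreserving R μ μ) (hfm : Measurable f) (hf : Integrable f μ) :
    0 ≤ ∫ x in {x | ∃ N, 0 < birkhoffSum R f N x}, f x ∂μ := by
  have hset : {x | ∃ N, 0 < birkhoffSum R f N x} = ⋃ n, {x | 0 < maxSum R f n x} := by
    ext x
    simp only [mem_ofPred_eq, mem_iUnion]
    constructor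
    · rintro ⟨N, hN⟩; exact ⟨N, hN.trans_le (birkhoffSum_le_maxSum R f N x)⟩
    · rintro ⟨n, hn⟩
      obtain ⟨k, hk⟩ := exists_birkhoffSum_pos R f n x
      exact ⟨k, hk ▸ hn⟩
  rw [hset]
  have hmono : Monotone fun n => {x | 0 < maxSum R f n x} := by
    apply monotone_nat_of_le_succ
    intro n x hx
    exact lt_of_lt_of_le hx (maxSum_mono R f n x)
  exact ge_of_tendsto' (tendsto_setIntegral_of_monotone
    (fun n => measurableSet_lt measurable_const (maxSum_measurable hR.measurable hfm n))
    hmono hf.integrableOn) (fun n => garsia hR hfm hf n)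

lemma birkhoffSum_sub_const (R : X → X) (f : X → ℝ) (t : ℝ) (N : ℕ) (x : X) :
    birkhoffSum R (fun x => f x - t) N x = birkhoffSum R f N x - N * t := by
  simp [birkhoffSum, Finset.sum_sub_distrib]

/-- the set where the upper Birkhoff average exceeds `t` -/
def bset (R : X → X) (f : X → ℝ) (t : ℝ) : Set X :=
  {x | ∃ n : ℕ, ∃ᶠ N : ℕ in atTop, (t + 1 / ((n : ℝ) + 1)) * N < birkhoffSum R f N x}

lemma measurable_birkhoffSum (hR : Measurable R) (hf : Measurable f) (N : ℕ) :
    Measurable (birkhoffSum R f N) := by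
  unfold birkhoffSum
  exact Finset.measurable_fun_sum _ fun i _ => hf.comp (hR.iterate i)

lemma bset_measurable (hR : Measurable R) (hf : Measurable f) (t : ℝ) :
    MeasurableSet (bset R f t) := by
  have : bset R f t = ⋃ n : ℕ, ⋂ a : ℕ, ⋃ N : ℕ, ⋃ (_ : a ≤ N),
      {x | (t + 1 / ((n : ℝ) + 1)) * N < birkhoffSum R f N x} := by
    ext x
    simp [bset, frequently_atTop]
  rw [this]
  refine MeasurableSet.iUnion fun n => MeasurableSet.iInter fun a => MeasurableSet.iUnion fun N =>
    MeasurableSet.iUnion fun _ => measurableSet_lt measurable_const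
      (measurable_birkhoffSum hR hf N)

lemma bset_invariant (R : X → X) (f : X → ℝ) (t : ℝ) (x : X) :
    R x ∈ bset R f t ↔ x ∈ bset R f t := by
  have hlin : ∀ (n : ℕ) (c : ℝ), ∀ᶠ N : ℕ in atTop, c ≤ (1/((n:ℝ)+1) - 1/((n:ℝ)+2)) * N := by
    intro n c
    have hpos : 0 < 1/((n:ℝ)+1) - 1/((n:ℝ)+2) := by
      have : 1/((n:ℝ)+2) < 1/((n:ℝ)+1) := by
        apply one_div_lt_one_div_of_lt <;> [positivity; linarith]
      linarith
    exact (tendsto_natCast_atTop_atTop.const_mul_atTop hpos).eventually_ge_atTop c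
  constructor
  · rintro ⟨n, hn⟩
    refine ⟨n + 1, ?_⟩
    have h2 := (hn.and_eventually (hlin n (|t| + 1 + |f x|)))
    have h3 : ∃ᶠ N : ℕ in atTop, (t + 1 / (((n + 1 : ℕ) : ℝ) + 1)) * ((N + 1 : ℕ) : ℝ)
        < birkhoffSum R f (N + 1) x := by
      refine h2.mono ?_
      rintro N ⟨hN1, hN2⟩
      rw [birkhoffSum_succ']
      push_cast
      have e : (n:ℝ) + 1 + 1 = n + 2 := by ring
      rw [e]
      have h1 : 1/((n:ℝ)+2) ≤ 1 := by
        rw [div_le_one (by positivity)]; linarith [(Nat.cast_nonneg n : (0:ℝ) ≤ n)]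
      nlinarith [neg_abs_le (f x), le_abs_self t]
    exact (tendsto_add_atTop_nat 1).frequently h3
  · rintro ⟨n, hn⟩
    refine ⟨n + 1, ?_⟩
    have h2 := (hn.and_eventually ((hlin n (|t| + 1 + |f x|)).and (eventually_ge_atTop 1)))
    have h3 : ∃ᶠ N : ℕ in atTop, (t + 1 / (((n + 1 : ℕ) : ℝ) + 1)) * ((N - 1 : ℕ) : ℝ)
        < birkhoffSum R f (N - 1) (R x) := by
      refine h2.mono ?_
      rintro N ⟨hN1, hN2, hN3⟩
      obtain ⟨K, rfl⟩ : ∃ K, N = K + 1 := ⟨N - 1, by omega⟩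
      rw [birkhoffSum_succ'] at hN1
      simp only [Nat.add_sub_cancel]
      push_cast at hN1 hN2 ⊢
      have e : (n:ℝ) + 1 + 1 = n + 2 := by ring
      rw [e]
      have h1 : 1/((n:ℝ)+2) ≤ 1 := by
        rw [div_le_one (by positivity)]; linarith [(Nat.cast_nonneg n : (0:ℝ) ≤ n)]
      have h1' : 0 ≤ 1/((n:ℝ)+2) := by positivity
      nlinarith [le_abs_self (f x), neg_abs_le t]
    exact (tendsto_sub_atTop_nat 1).frequently h3

lemma bset_subset (R : X → X) (f : X → ℝ) (t : ℝ) :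
    bset R f t ⊆ {x | ∃ N, 0 < birkhoffSum R (fun x => f x - t) N x} := by
  rintro x ⟨n, hn⟩
  obtain ⟨N, hN, hN1⟩ := (hn.and_eventually (eventually_ge_atTop 1)).exists
  refine ⟨N, ?_⟩
  rw [birkhoffSum_sub_const]
  have h1' : 0 ≤ 1/((n:ℝ)+1) * N := by positivity
  nlinarith

lemma maximal_ineq (hR : MeasurePreserving R μ μ) (hfm : Measurable f) (hf : Integrable f μ)
    (hf0 : ∀ x, 0 ≤ f x) (t : ℝ) : μ.real (bset R f t) * t ≤ ∫ x, f x ∂μ := by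
  rcases le_or_gt t 0 with ht | ht
  · exact (mul_nonpos_of_nonneg_of_nonpos measureReal_nonneg ht).trans (integral_nonneg hf0)
  have h := maximal_ergodic hR (hfm.sub_const t) (hf.sub (integrable_const t))
  set E := {x | ∃ N, 0 < birkhoffSum R (fun x => f x - t) N x}
  rw [integral_sub hf.integrableOn (integrable_const t).integrableOn] at h
  simp only [integral_const, MeasurableSet.univ, measureReal_restrict_apply, univ_inter,
    smul_eq_mul] at h
  have h2 : ∫ x in E, f x ∂μ ≤ ∫ x, f x ∂μ :=
    setIntegral_le_integral hf (Eventually.of_forall hf0)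
  have h3 : μ.real (bset R f t) ≤ μ.real E := measureReal_mono (bset_subset R f t)
  nlinarith

end Maximal

section Birkhoff
variable {X : Type*} [MeasurableSpace X] {μ : Measure X} [IsProbabilityMeasure μ]
  {R : X → X} {f : X → ℝ}

lemma ergodic_upper (hR : Ergodic R μ) (hfm : Measurable f) (hf : Integrable f μ)
    (t : ℝ) (ht : ∫ x, f x ∂μ < t) : ∀ᵐ x ∂μ, x ∉ bset R f t := by
  have hinv : R ⁻¹' (bset R f t) = bset R f t := by
    ext x; exact bset_invariant R f t x
  have := hR.toPreErgodic.aeconst_set (bset_measurable hR.measurable hfm t) hinv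
  rcases eventuallyConst_set.1 this with h | h
  · exfalso
    have h1 := maximal_ergodic hR.toMeasurePreserving (hfm.sub_const t) (hf.sub (integrable_const t))
    have h2 : ∀ᵐ x ∂μ, x ∈ {x | ∃ N, 0 < birkhoffSum R (fun x => f x - t) N x} := by
      filter_upwards [h] with x hx
      exact bset_subset R f t hx
    rw [Measure.restrict_eq_self_of_ae_mem h2,
      integral_sub hf (integrable_const t)] at h1
    simp at h1
    linarith
  · exact h

lemma birkhoff_ergodic (hR : Ergodic R μ) (hfm : Measurable f) (hf : Integrable f μ) :
    ∀ᵐ x ∂μ, Tendsto (fun N : ℕ => (1 / N : ℝ) * ∑ i ∈ Finset.range N, f (R^[i] x)) atTop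
      (𝓝 (∫ x, f x ∂μ)) := by
  have h1 : ∀ᵐ x ∂μ, ∀ n : ℕ, x ∉ bset R f (∫ x, f x ∂μ + 1 / ((n:ℝ) + 1)) :=
    ae_all_iff.2 fun n => ergodic_upper hR hfm hf _ (by
      have : 0 < 1 / ((n:ℝ) + 1) := by positivity
      linarith)
  have h2 : ∀ᵐ x ∂μ, ∀ n : ℕ, x ∉ bset R (fun x => - f x) (∫ x, - f x ∂μ + 1 / ((n:ℝ) + 1)) :=
    ae_all_iff.2 fun n => ergodic_upper (f := fun x => - f x) hR hfm.neg hf.neg _ (by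
      have : 0 < 1 / ((n:ℝ) + 1) := by positivity
      linarith)
  filter_upwards [h1, h2] with x hx1 hx2
  rw [Metric.tendsto_atTop']
  intro ε hε
  obtain ⟨n, hn⟩ := exists_nat_one_div_lt (show 0 < ε / 3 by positivity)
  have e1 := hx1 n
  have e2 := hx2 n
  simp only [bset, mem_ofPred_eq, not_exists, not_frequently, not_lt] at e1 e2
  obtain ⟨a, ha⟩ := eventually_atTop.1 ((e1 n).and ((e2 n).and (eventually_ge_atTop 1)))
  refine ⟨a, fun N hN => ?_⟩
  obtain ⟨b1, b2, b3⟩ := ha N hN.le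
  rw [integral_neg] at b2
  have hNpos : (0:ℝ) < N := by exact_mod_cast b3
  have hs : birkhoffSum R (fun x => - f x) N x = - birkhoffSum R f N x := by
    simp [birkhoffSum]
  rw [hs] at b2
  have hbs : birkhoffSum R f N x = ∑ i ∈ Finset.range N, f (R^[i] x) := rfl
  rw [← hbs, Real.dist_eq, abs_lt]
  constructor
  · have : (∫ x, f x ∂μ - ε) < 1 / N * birkhoffSum R f N x := by
      rw [one_div, ← div_eq_inv_mul, lt_div_iff₀ hNpos]; nlinarith
    linarith
  · have : 1 / N * birkhoffSum R f N x < (∫ x, f x ∂μ + ε) := by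
      rw [one_div, ← div_eq_inv_mul, div_lt_iff₀ hNpos]; nlinarith
    linarith

end Birkhoff
end SEq

namespace SEq
section LLN
variable {Ω : Type*} [MeasurableSpace Ω] {P : Measure Ω} [IsProbabilityMeasure P]

lemma sum_half_le (N : ℕ) : ∑ i ∈ Finset.range N, (1/2 : ℝ) ^ (N - i) ≤ 1 := by
  have h : ∀ N : ℕ, ∑ i ∈ Finset.range N, (1/2 : ℝ) ^ (N - i) = 1 - (1/2)^N := by
    intro N
    induction N with
    | zero => simp
    | succ N ih =>
      rw [Finset.sum_range_succ]
      have : ∑ i ∈ Finset.range N, (1/2 : ℝ) ^ (N + 1 - i) =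
          (1/2) * ∑ i ∈ Finset.range N, (1/2 : ℝ) ^ (N - i) := by
        rw [Finset.mul_sum]
        apply Finset.sum_congr rfl
        intro i hi
        rw [Finset.mem_range] at hi
        rw [show N + 1 - i = (N - i) + 1 by omega, pow_succ]; ring
      rw [this, ih]
      simp; ring
  rw [h]
  have : (0:ℝ) ≤ (1/2)^N := by positivity
  linarith

lemma second_moment {d : ℕ → Ω → ℂ} {M K : ℝ} (hK : 0 ≤ K) (hd : ∀ i, Measurable (d i))
    (hM : ∀ i ω, ‖d i ω‖ ≤ M)
    (hcor : ∀ i j, i < j → |∫ ω, inner ℝ (d i ω) (d j ω) ∂P| ≤ K * (1/2)^(j - i)) (N : ℕ) :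
    ∫ ω, ‖∑ i ∈ Finset.range N, d i ω‖ ^ 2 ∂P ≤ (2 * K + M ^ 2) * N := by
  have hbd : ∀ N ω, ‖∑ i ∈ Finset.range N, d i ω‖ ≤ N * M := by
    intro N ω
    calc _ ≤ ∑ i ∈ Finset.range N, ‖d i ω‖ := norm_sum_le _ _
      _ ≤ ∑ i ∈ Finset.range N, M := Finset.sum_le_sum fun i _ => hM i ω
      _ = N * M := by simp
  have hms : ∀ N, Measurable fun ω => ∑ i ∈ Finset.range N, d i ω := fun N =>
    Finset.measurable_fun_sum _ fun i _ => hd i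
  have hIntg : ∀ N, Integrable (fun ω => ‖∑ i ∈ Finset.range N, d i ω‖ ^ 2) P := by
    intro N
    refine Integrable.of_bound ((hms N).norm.pow_const 2).aestronglyMeasurable ((N * M)^2) ?_
    refine Eventually.of_forall fun ω => ?_
    rw [Real.norm_of_nonneg (by positivity)]
    exact pow_le_pow_left₀ (norm_nonneg _) (hbd N ω) 2
  have hinti : ∀ i j, Integrable (fun ω => inner ℝ (d i ω) (d j ω)) P := by
    intro i j
    refine Integrable.of_bound ((hd i).inner (hd j)).aestronglyMeasurable (M * M) ?_
    refine Eventually.of_forall fun ω => ?_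
    exact (norm_inner_le_norm _ _).trans (mul_le_mul (hM i ω) (hM j ω) (norm_nonneg _)
      ((norm_nonneg _).trans (hM i ω)))
  have hintd : ∀ i, Integrable (fun ω => ‖d i ω‖ ^ 2) P := by
    intro i
    refine Integrable.of_bound ((hd i).norm.pow_const 2).aestronglyMeasurable (M^2) ?_
    refine Eventually.of_forall fun ω => ?_
    rw [Real.norm_of_nonneg (by positivity)]
    exact pow_le_pow_left₀ (norm_nonneg _) (hM i ω) 2
  induction N with
  | zero => simp
  | succ N ih =>
    have h1 : ∀ ω, ‖∑ i ∈ Finset.range (N+1), d i ω‖ ^ 2 =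
        (‖∑ i ∈ Finset.range N, d i ω‖ ^ 2 + 2 * ∑ i ∈ Finset.range N, inner ℝ (d i ω) (d N ω))
          + ‖d N ω‖^2 := by
      intro ω
      rw [Finset.sum_range_succ, norm_add_sq_real, sum_inner]
    have hs : Integrable (fun ω => 2 * ∑ i ∈ Finset.range N, inner ℝ (d i ω) (d N ω)) P :=
      (integrable_finsetSum _ fun i _ => hinti i N).const_mul 2
    simp_rw [h1]
    have hadd : Integrable (fun ω => ‖∑ i ∈ Finset.range N, d i ω‖ ^ 2 +
        2 * ∑ i ∈ Finset.range N, inner ℝ (d i ω) (d N ω)) P := (hIntg N).add hs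
    rw [integral_add hadd (hintd N), integral_add (hIntg N) hs, integral_const_mul,
      integral_finsetSum _ fun i _ => hinti i N]
    have h2 : ∑ i ∈ Finset.range N, ∫ ω, inner ℝ (d i ω) (d N ω) ∂P ≤ K := by
      calc _ ≤ ∑ i ∈ Finset.range N, K * (1/2)^(N - i) := Finset.sum_le_sum fun i hi =>
            (le_abs_self _).trans (hcor i N (Finset.mem_range.1 hi))
        _ = K * ∑ i ∈ Finset.range N, (1/2 : ℝ)^(N - i) := by rw [Finset.mul_sum]
        _ ≤ K * 1 := by gcongr; exact sum_half_le N
        _ = K := mul_one K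
    have h3 : ∫ ω, ‖d N ω‖^2 ∂P ≤ M^2 := by
      calc _ ≤ ∫ ω, M^2 ∂P := integral_mono (hintd N) (integrable_const _)
            fun ω => pow_le_pow_left₀ (norm_nonneg _) (hM N ω) 2
        _ = M^2 := by simp
    push_cast
    linarith

lemma lln {d : ℕ → Ω → ℂ} {M K : ℝ} (hK : 0 ≤ K) (hd : ∀ i, Measurable (d i))
    (hM : ∀ i ω, ‖d i ω‖ ≤ M)
    (hcor : ∀ i j, i < j → |∫ ω, inner ℝ (d i ω) (d j ω) ∂P| ≤ K * (1/2)^(j - i)) :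
    ∀ᵐ ω ∂P, ∀ ε : ℝ, 0 < ε → ∀ᶠ N : ℕ in atTop,
      ‖∑ i ∈ Finset.range N, d i ω‖ ≤ ε * N := by
  have hM0 : 0 ≤ M := by
    obtain ⟨ω⟩ : Nonempty Ω := P.nonempty_of_neZero
    exact (norm_nonneg _).trans (hM 0 ω)
  set C := 2 * K + M ^ 2 with hC
  have hC0 : 0 ≤ C := by positivity
  have hms : ∀ N, Measurable fun ω => ∑ i ∈ Finset.range N, d i ω := fun N =>
    Finset.measurable_fun_sum _ fun i _ => hd i
  -- summability along squares
  let g : ℕ → Ω → ℝ≥0∞ := fun n ω =>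
    ENNReal.ofReal (‖∑ i ∈ Finset.range ((n+1)^2), d i ω‖ ^ 2 / ((n:ℝ)+1)^4)
  have hg : ∀ n, ∫⁻ ω, g n ω ∂P ≤ ENNReal.ofReal (C / ((n:ℝ)+1)^2) := by
    intro n
    rw [← ofReal_integral_eq_lintegral_ofReal]
    · apply ENNReal.ofReal_le_ofReal
      rw [integral_div, div_le_div_iff₀ (by positivity) (by positivity)]
      have := second_moment (P := P) hK hd hM hcor ((n+1)^2)
      push_cast at this
      calc _ ≤ ((2 * K + M ^ 2) * ((n:ℝ)+1)^2) * ((n:ℝ)+1)^2 := by gcongr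
        _ = _ := by rw [hC]; ring
    · refine Integrable.of_bound
        (((hms _).norm.pow_const 2).div_const _).aestronglyMeasurable
        (((((n+1)^2 : ℕ):ℝ) * M)^2 / ((n:ℝ)+1)^4) (Eventually.of_forall fun ω => ?_)
      rw [Real.norm_of_nonneg (by positivity)]
      gcongr
      calc _ ≤ ∑ i ∈ Finset.range ((n+1)^2), ‖d i ω‖ := norm_sum_le _ _
        _ ≤ ∑ i ∈ Finset.range ((n+1)^2), M := Finset.sum_le_sum fun i _ => hM i ω
        _ = _ := by simp
    · exact Eventually.of_forall fun ω => by positivity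
  have hgm : ∀ n, Measurable (g n) := fun n =>
    (((hms _).norm.pow_const 2).div_const _).ennreal_ofReal
  have hsum : ∫⁻ ω, ∑' n, g n ω ∂P ≠ ∞ := by
    rw [lintegral_tsum fun n => (hgm n).aemeasurable]
    have hS : Summable fun n : ℕ => C / ((n:ℝ)+1)^2 := by
      have := (summable_nat_add_iff 1).2 (Real.summable_one_div_nat_pow.2 (one_lt_two))
      have h2 := this.mul_left C
      refine h2.congr fun n => ?_
      push_cast; ring
    refine ne_top_of_le_ne_top ?_ (ENNReal.tsum_le_tsum hg)
    exact hS.tsum_ofReal_ne_top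
  have hae := ae_lt_top (Measurable.tsum hgm) hsum
  filter_upwards [hae] with ω hω ε hε
  have ht : Tendsto (fun n => g n ω) atTop (𝓝 0) :=
    ENNReal.tendsto_atTop_zero_of_tsum_ne_top hω.ne
  have hev : ∀ᶠ n : ℕ in atTop,
      ‖∑ i ∈ Finset.range (n^2), d i ω‖ ≤ (ε/2) * (n:ℝ)^2 := by
    have h1 : ∀ᶠ n in atTop, g n ω < ENNReal.ofReal ((ε/2)^2) :=
      ht.eventually_lt_const (by simp; positivity)
    have h2 : ∀ᶠ n : ℕ in atTop,
      ‖∑ i ∈ Finset.range ((n+1)^2), d i ω‖ ≤ (ε/2) * ((n+1 : ℕ):ℝ)^2 := by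
      filter_upwards [h1] with n hn
      rw [ENNReal.ofReal_lt_ofReal_iff (by positivity), div_lt_iff₀ (by positivity)] at hn
      refine abs_le_of_sq_le_sq' ?_ (by positivity) |>.2
      push_cast
      nlinarith
    obtain ⟨a, ha⟩ := eventually_atTop.1 h2
    refine eventually_atTop.2 ⟨a + 1, fun n hn => ?_⟩
    obtain ⟨k, rfl⟩ : ∃ k, n = k + 1 := ⟨n - 1, by omega⟩
    exact ha k (by omega)
  obtain ⟨a, ha⟩ := eventually_atTop.1 hev
  obtain ⟨b, hb⟩ := exists_nat_gt (4 * M / ε)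
  refine eventually_atTop.2 ⟨(max a b)^2 + 1, fun N hN => ?_⟩
  set n := Nat.sqrt N with hn
  have hn1 : n ^ 2 ≤ N := Nat.sqrt_le' N
  have hn2 : N < (n + 1)^2 := Nat.lt_succ_sqrt' N
  have hn3 : max a b ≤ n := by
    rw [hn, Nat.le_sqrt']; omega
  have h1 := ha n ((le_max_left _ _).trans hn3)
  have hsplit : ∑ i ∈ Finset.range N, d i ω =
      ∑ i ∈ Finset.range (n^2), d i ω + ∑ i ∈ Finset.Ico (n^2) N, d i ω :=
    (Finset.sum_range_add_sum_Ico _ hn1).symm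
  have h2 : ‖∑ i ∈ Finset.Ico (n^2) N, d i ω‖ ≤ 2 * n * M := by
    calc _ ≤ ∑ i ∈ Finset.Ico (n^2) N, ‖d i ω‖ := norm_sum_le _ _
      _ ≤ ∑ i ∈ Finset.Ico (n^2) N, M := Finset.sum_le_sum fun i _ => hM i ω
      _ = ((N - n^2 : ℕ):ℝ) * M := by simp
      _ ≤ ((2 * n : ℕ):ℝ) * M := by
        gcongr
        have : (n+1)^2 = n^2 + 2 * n + 1 := by ring
        omega
      _ = _ := by push_cast; ring
  have hnb : 4 * M / ε < n := hb.trans_le (by exact_mod_cast (le_max_right _ _).trans hn3)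
  rw [div_lt_iff₀ hε] at hnb
  have hNr : (n:ℝ)^2 ≤ N := by exact_mod_cast hn1
  rw [hsplit]
  refine (norm_add_le _ _).trans ?_
  have hn0 : (0:ℝ) ≤ n := Nat.cast_nonneg n
  nlinarith
end LLN
end SEq

namespace SEq

/-- one-sided shift -/
def shift {p : ℕ} (y : ℕ → Fin p) : ℕ → Fin p := fun n => y (n + 1)
/-- two-sided shift -/
def tshift {p : ℕ} (w : ℤ → Fin p) : ℤ → Fin p := fun n => w (n + 1)
/-- future coordinates -/
def fut {p : ℕ} (w : ℤ → Fin p) : ℕ → Fin p := fun n => w n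
/-- past coordinates -/
def past {p : ℕ} (w : ℤ → Fin p) : ℕ → Fin p := fun n => w (-1 - n)

lemma measurable_shift {p : ℕ} : Measurable (shift (p := p)) :=
  measurable_pi_lambda _ fun n => measurable_pi_apply _
lemma measurable_tshift {p : ℕ} : Measurable (tshift (p := p)) :=
  measurable_pi_lambda _ fun n => measurable_pi_apply _
lemma measurable_fut {p : ℕ} : Measurable (fut (p := p)) :=
  measurable_pi_lambda _ fun n => measurable_pi_apply _
lemma measurable_past {p : ℕ} : Measurable (past (p := p)) :=
  measurable_pi_lambda _ fun n => measurable_pi_apply _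
lemma continuous_tshift {p : ℕ} : Continuous (tshift (p := p)) :=
  continuous_pi fun n => continuous_apply _
lemma continuous_fut {p : ℕ} : Continuous (fut (p := p)) :=
  continuous_pi fun n => continuous_apply _

lemma iterate_tshift {p : ℕ} (k : ℕ) (w : ℤ → Fin p) (n : ℤ) :
    (tshift^[k] w) n = w (n + k) := by
  induction k generalizing w with
  | zero => simp
  | succ k ih => rw [Function.iterate_succ_apply, ih]; simp only [tshift]; push_cast; ring_nf

lemma iterate_shift {p : ℕ} (k : ℕ) (w : ℕ → Fin p) (n : ℕ) :
    (shift^[k] w) n = w (n + k) := by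
  induction k generalizing w with
  | zero => simp
  | succ k ih => rw [Function.iterate_succ_apply, ih]; simp only [shift]; ring_nf

/-- the two-sided sequences approximating the natural extension -/
def extk {p : ℕ} (k : ℕ) (y : ℕ → Fin p) : ℤ → Fin p := fun n => y (n + k).toNat

lemma measurable_extk {p : ℕ} (k : ℕ) : Measurable (extk (p := p) k) :=
  measurable_pi_lambda _ fun n => measurable_pi_apply _

lemma natExt {p : ℕ} (ν : Measure (ℕ → Fin p)) [IsProbabilityMeasure ν]
    (hν : MeasurePreserving shift ν ν) :
    ∃ P : Measure (ℤ → Fin p), IsProbabilityMeasure P ∧ MeasurePreserving tshift P P ∧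
      P.map fut = ν := by
  let Q : ℕ → ProbabilityMeasure (ℤ → Fin p) := fun k =>
    ⟨ν.map (extk k), Measure.isProbabilityMeasure_map (measurable_extk k).aemeasurable⟩
  let U : Ultrafilter ℕ := Ultrafilter.of atTop
  have hU : (U : Filter ℕ) ≤ atTop := Ultrafilter.of_le _
  obtain ⟨P, -, hP⟩ := isCompact_univ.ultrafilter_le_nhds (U.map Q) (by simp)
  have hPt : Tendsto Q U (𝓝 P) := hP
  rw [ProbabilityMeasure.tendsto_iff_forall_integral_tendsto] at hPt
  have hQ : ∀ (k : ℕ) (f : BoundedContinuousFunction (ℤ → Fin p) ℝ),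
      ∫ w, f w ∂(Q k : Measure (ℤ → Fin p)) = ∫ y, f (extk k y) ∂ν := by
    intro k f
    exact integral_map (measurable_extk k).aemeasurable f.continuous.aestronglyMeasurable
  refine ⟨P, inferInstance, ⟨measurable_tshift, ?_⟩, ?_⟩
  · have : IsProbabilityMeasure ((P : Measure (ℤ → Fin p)).map tshift) :=
      Measure.isProbabilityMeasure_map measurable_tshift.aemeasurable
    apply ext_of_forall_integral_eq_of_IsFiniteMeasure
    intro f
    rw [integral_map measurable_tshift.aemeasurable f.continuous.aestronglyMeasurable]
    let g : BoundedContinuousFunction (ℤ → Fin p) ℝ :=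
      f.compContinuous ⟨tshift, continuous_tshift⟩
    have h1 := hPt f
    have h2 := hPt g
    have h3 : Tendsto (fun k => ∫ w, g w ∂(Q k : Measure (ℤ → Fin p)) -
        ∫ w, f w ∂(Q k : Measure (ℤ → Fin p))) atTop (𝓝 0) := by
      have hk : ∀ k, ∫ w, g w ∂(Q k : Measure (ℤ → Fin p)) -
          ∫ w, f w ∂(Q k : Measure (ℤ → Fin p)) =
          ∫ y, (f (tshift (extk k y)) - f (extk k (shift y))) ∂ν := by
        intro k
        rw [hQ, hQ]
        have e : ∫ y, f (extk k y) ∂ν = ∫ y, f (extk k (shift y)) ∂ν := by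
          conv_lhs => rw [← hν.map_eq]
          exact integral_map measurable_shift.aemeasurable
            (f.continuous.measurable.comp (measurable_extk k)).aestronglyMeasurable
        rw [e, integral_sub]
        · rfl
        · exact Integrable.of_bound (f.continuous.measurable.comp
            (measurable_tshift.comp (measurable_extk k))).aestronglyMeasurable ‖f‖
            (Eventually.of_forall fun y => f.norm_coe_le_norm _)
        · exact Integrable.of_bound (f.continuous.measurable.comp
            ((measurable_extk k).comp measurable_shift)).aestronglyMeasurable ‖f‖
            (Eventually.of_forall fun y => f.norm_coe_le_norm _)
      simp_rw [hk]
      rw [show (0:ℝ) = ∫ y, (0:ℝ) ∂ν by simp]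
      refine tendsto_integral_of_dominated_convergence (fun _ => 2 * ‖f‖) ?_
        (integrable_const _) ?_ ?_
      · intro k
        exact ((f.continuous.measurable.comp
            (measurable_tshift.comp (measurable_extk k))).sub (f.continuous.measurable.comp
            ((measurable_extk k).comp measurable_shift))).aestronglyMeasurable
      · intro k
        refine Eventually.of_forall fun y => ?_
        refine (norm_sub_le _ _).trans ?_
        have := f.norm_coe_le_norm (tshift (extk k y))
        have := f.norm_coe_le_norm (extk k (shift y))
        linarith
      · refine Eventually.of_forall fun y => ?_
        let _ : UniformSpace (Fin p) := ⊥
        have huc : UniformContinuous f :=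
          CompactSpace.uniformContinuous_of_continuous f.continuous
        have : Tendsto (fun k => (tshift (extk k y), extk k (shift y))) atTop
            (uniformity (ℤ → Fin p)) := by
          rw [Pi.uniformity, tendsto_iInf]
          intro n
          rw [tendsto_comap_iff]
          have hev : ∀ᶠ k : ℕ in atTop, tshift (extk k y) n = extk k (shift y) n := by
            filter_upwards [eventually_ge_atTop (n.natAbs + 1)] with k hk
            simp only [tshift, extk, shift]
            congr 1
            omega
          refine Tendsto.congr' (f₁ := fun k => (extk k (shift y) n, extk k (shift y) n)) ?_ ?_
          · filter_upwards [hev] with k hk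
            simp [hk]
          · exact tendsto_diag_uniformity _ _
        have h4 : Tendsto (fun k => (f (tshift (extk k y)), f (extk k (shift y)))) atTop
            (uniformity ℝ) := Tendsto.comp huc this
        have h5 := tendsto_uniformity_iff_dist_tendsto_zero.1 h4
        rw [tendsto_zero_iff_norm_tendsto_zero]
        simpa [Real.dist_eq] using h5
    have h4 := (h2.sub h1)
    have h5 := tendsto_nhds_unique h4 (h3.mono_left hU)
    exact sub_eq_zero.1 h5
  · have : IsProbabilityMeasure ((P : Measure (ℤ → Fin p)).map fut) :=
      Measure.isProbabilityMeasure_map measurable_fut.aemeasurable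
    apply ext_of_forall_integral_eq_of_IsFiniteMeasure
    intro f
    rw [integral_map measurable_fut.aemeasurable f.continuous.aestronglyMeasurable]
    let g : BoundedContinuousFunction (ℤ → Fin p) ℝ :=
      f.compContinuous ⟨fut, continuous_fut⟩
    have h2 := hPt g
    have hk : ∀ k, ∫ w, g w ∂(Q k : Measure (ℤ → Fin p)) = ∫ y, f y ∂ν := by
      intro k
      rw [hQ]
      have e : ∀ y, g (extk k y) = f (shift^[k] y) := by
        intro y
        change f (fut (extk k y)) = _
        congr 1
        ext n
        rw [iterate_shift]
        simp only [fut, extk]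
        congr 2
      simp_rw [e]
      conv_rhs => rw [← (hν.iterate k).map_eq]
      exact (integral_map (hν.iterate k).measurable.aemeasurable
        f.continuous.aestronglyMeasurable).symm
    simp_rw [hk] at h2
    exact (tendsto_nhds_unique h2 tendsto_const_nhds)
end SEq

namespace SEq
open ProbabilityTheory

/-- prepend a digit -/
def cons {p : ℕ} (d : Fin p) (b : ℕ → Fin p) : ℕ → Fin p
  | 0 => d
  | n + 1 => b n

lemma measurable_cons {p : ℕ} {α : Type*} [MeasurableSpace α] {u : α → Fin p} {v : α → ℕ → Fin p}
    (hu : Measurable u) (hv : Measurable v) : Measurable (fun a => cons (u a) (v a)) := by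
  refine measurable_pi_lambda _ fun n => ?_
  cases n with
  | zero => exact hu
  | succ n => exact (measurable_pi_apply n).comp hv

lemma past_tshift {p : ℕ} (w : ℤ → Fin p) : past (tshift w) = cons (w 0) (past w) := by
  ext n
  cases n with
  | zero => simp [past, tshift, cons]
  | succ n => simp only [past, tshift, cons]; congr 2; push_cast; ring

lemma fut_eq_cons {p : ℕ} (w : ℤ → Fin p) : fut w = cons (w 0) (fut (tshift w)) := by
  ext n
  cases n with
  | zero => simp [fut, cons]
  | succ n => simp only [fut, tshift, cons]; congr 2

lemma cons_inj {p : ℕ} {d d' : Fin p} {b b' : ℕ → Fin p} : cons d b = cons d' b' ↔ d = d' ∧ b = b' := by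
  constructor
  · intro h
    exact ⟨congrFun h 0, funext fun n => congrFun h (n+1)⟩
  · rintro ⟨rfl, rfl⟩; rfl

section
variable {p : ℕ} [NeZero p] (P : Measure (ℤ → Fin p)) [IsProbabilityMeasure P]

/-- disintegration of the future over the past -/
noncomputable def kap : Kernel (ℕ → Fin p) (ℕ → Fin p) := condDistrib fut past P

instance : IsMarkovKernel (kap P) := by unfold kap; infer_instance

lemma kap_lintegral {F : (ℕ → Fin p) → (ℕ → Fin p) → ℝ≥0∞} (hF : Measurable (Function.uncurry F)) :
    ∫⁻ ω, ∫⁻ y, F (past ω) y ∂(kap P (past ω)) ∂P = ∫⁻ ω, F (past ω) (fut ω) ∂P := by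
  have h := compProd_map_condDistrib (mβ := MeasurableSpace.pi) (X := past) (Y := fut) (μ := P) measurable_fut.aemeasurable
  have h2 := Measure.lintegral_compProd (μ := P.map past) (κ := kap P) hF
  simp only [Function.uncurry_apply_pair] at h2
  rw [lintegral_map (Measurable.lintegral_kernel_prod_right hF) measurable_past] at h2
  rw [← show _ = ∫⁻ ω, ∫⁻ y, F (past ω) y ∂(kap P (past ω)) ∂P from h2]
  unfold kap
  rw [h, lintegral_map hF (measurable_past.prodMk measurable_fut)]
  rfl

/-- the kernel one gets by iterating once -/
noncomputable def kap1 : Kernel (ℕ → Fin p) (ℕ → Fin p) :=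
  ((kap P) ⊗ₖ ((kap P).comap (fun z : (ℕ → Fin p) × (ℕ → Fin p) => cons (z.2 0) z.1)
    (measurable_cons ((measurable_pi_apply 0).comp measurable_snd) measurable_fst))).map
    (fun z => cons (z.1 0) z.2)

lemma measurable_map1 : Measurable (fun z : (ℕ → Fin p) × (ℕ → Fin p) => cons (z.1 0) z.2) :=
  measurable_cons ((measurable_pi_apply 0).comp measurable_fst) measurable_snd

lemma kap1_lintegral (b : ℕ → Fin p) {F : (ℕ → Fin p) → ℝ≥0∞} (hF : Measurable F) :
    ∫⁻ y, F y ∂(kap1 P b) = ∫⁻ y, ∫⁻ y', F (cons (y 0) y') ∂(kap P (cons (y 0) b)) ∂(kap P b) := by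
  unfold kap1
  rw [Kernel.map_apply _ measurable_map1, lintegral_map hF measurable_map1, Kernel.lintegral_compProd]
  · simp only [Kernel.comap_apply]
  · exact hF.comp measurable_map1

instance : IsMarkovKernel (kap1 P) := by
  unfold kap1
  exact Kernel.IsMarkovKernel.map _ measurable_map1

lemma kap_ae_eq (hP : MeasurePreserving tshift P P) : ∀ᵐ ω ∂P, kap P (past ω) = kap1 P (past ω) := by
  have : P.map (fun ω => (past ω, fut ω)) = P.map past ⊗ₘ kap1 P := by
    refine Measure.ext_of_lintegral _ fun F hF => ?_
    rw [lintegral_map hF (measurable_past.prodMk measurable_fut),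
      Measure.lintegral_compProd hF, lintegral_map (Measurable.lintegral_kernel_prod_right
        (f := fun a b => F (a, b)) hF) measurable_past]
    have hF' : ∀ b, Measurable fun y => F (b, y) := fun b => hF.comp measurable_prodMk_left
    simp_rw [kap1_lintegral P _ (hF' _)]
    have m1 : Measurable (Function.uncurry fun b y : ℕ → Fin p =>
        ∫⁻ y', F (b, cons (y 0) y') ∂(kap P (cons (y 0) b))) := by
      have hm : Measurable (fun z : (ℕ → Fin p) × (ℕ → Fin p) => cons (z.2 0) z.1) :=
        (measurable_cons ((measurable_pi_apply 0).comp measurable_snd) measurable_fst)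
      have := Measurable.lintegral_kernel_prod_right (κ := (kap P).comap _ hm)
        (f := fun z y' => F (z.1, cons (z.2 0) y')) (by
          refine hF.comp (Measurable.prodMk (measurable_fst.comp measurable_fst) ?_)
          exact measurable_cons ((measurable_pi_apply 0).comp (measurable_snd.comp measurable_fst))
            measurable_snd)
      exact this
    rw [kap_lintegral P m1]
    have e1 : ∀ ω : ℤ → Fin p, ∫⁻ y', F (past ω, cons (fut ω 0) y') ∂(kap P (cons (fut ω 0) (past ω))) =
        (fun ω' => ∫⁻ y', F (shift (past ω'), cons (past ω' 0) y') ∂(kap P (past ω'))) (tshift ω) := by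
      intro ω
      simp only [past_tshift]
      rfl
    simp_rw [e1]
    have m2 : Measurable (Function.uncurry fun b y' : ℕ → Fin p => F (shift b, cons (b 0) y')) :=
      hF.comp (Measurable.prodMk (measurable_shift.comp measurable_fst)
        (measurable_cons ((measurable_pi_apply 0).comp measurable_fst) measurable_snd))
    rw [hP.lintegral_comp (f := fun ω' => ∫⁻ y', F (shift (past ω'), cons (past ω' 0) y') ∂(kap P (past ω')))
      ((Measurable.lintegral_kernel_prod_right m2).comp measurable_past)]
    rw [kap_lintegral P m2]
    rw [← hP.lintegral_comp (f := fun ω => F (shift (past ω), cons (past ω 0) (fut ω)))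
      (m2.comp (measurable_past.prodMk measurable_fut))]
    congr 1
    ext ω
    rw [past_tshift]
    conv_lhs => rw [fut_eq_cons]
    rfl
  have h := condDistrib_ae_eq_of_measure_eq_compProd_of_measurable measurable_past measurable_fut this
  exact ae_of_ae_map measurable_past.aemeasurable h

/-- conditional mass of the true future -/
noncomputable def fmass (ω : ℤ → Fin p) : ℝ≥0∞ := kap P (past ω) {fut ω}
/-- conditional mass of the true next digit -/
noncomputable def gmass (ω : ℤ → Fin p) : ℝ≥0∞ := kap P (past ω) {y | y 0 = ω 0}

lemma measurable_fmass : Measurable (fmass P) := by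
  let K : Kernel ((ℕ → Fin p) × (ℕ → Fin p)) (ℕ → Fin p) := (kap P).comap Prod.fst measurable_fst
  have h1 : Measurable (fun z : (ℕ → Fin p) × (ℕ → Fin p) => K z (Prod.mk z ⁻¹' {t | t.2 = t.1.2})) := by
    refine Kernel.measurable_kernel_prodMk_left (κ := K) ?_
    exact measurableSet_eq_fun measurable_snd (measurable_snd.comp measurable_fst)
  exact h1.comp (measurable_past.prodMk measurable_fut)

lemma fmass_eq (hP : MeasurePreserving tshift P P) : ∀ᵐ ω ∂P, fmass P ω = gmass P ω * fmass P (tshift ω) := by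
  filter_upwards [kap_ae_eq P hP] with ω hω
  have hs : ∀ y : ℕ → Fin p, MeasurableSet ({y} : Set (ℕ → Fin p)) := fun y => measurableSet_singleton y
  unfold fmass gmass
  conv_lhs => rw [hω]
  rw [← lintegral_indicator_one (hs _), kap1_lintegral _ _ (measurable_one.indicator (hs _))]
  have hm : MeasurableSet {y : ℕ → Fin p | y 0 = ω 0} := measurableSet_eq_fun (measurable_pi_apply 0) measurable_const
  have e : ∀ y : ℕ → Fin p, ∫⁻ y', ({fut ω} : Set (ℕ → Fin p)).indicator 1 (cons (y 0) y')
      ∂(kap P (cons (y 0) (past ω))) =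
      ({y : ℕ → Fin p | y 0 = ω 0}).indicator (fun _ => kap P (past (tshift ω)) {fut (tshift ω)}) y := by
    intro y
    by_cases hy : y 0 = ω 0
    · rw [indicator_of_mem (by exact hy), hy, ← past_tshift, ← lintegral_indicator_one (hs _)]
      congr 1
      ext y'
      rw [fut_eq_cons ω]
      by_cases h : y' = fut (tshift ω)
      · simp [h]
      · rw [indicator_of_notMem, indicator_of_notMem]
        · simpa using h
        · simp only [mem_singleton_iff, cons_inj]; tauto
    · rw [indicator_of_notMem (by exact hy)]
      rw [lintegral_eq_zero_iff']
      · refine Eventually.of_forall fun y' => ?_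
        simp only [Pi.zero_apply]
        rw [indicator_of_notMem]
        · rw [fut_eq_cons ω]
          simp only [mem_singleton_iff, cons_inj]; tauto
      · exact ((measurable_one.indicator (hs _)).comp
          (measurable_cons measurable_const measurable_id)).aemeasurable
  simp_rw [e]
  rw [lintegral_indicator hm, lintegral_const, Measure.restrict_apply_univ, mul_comm]

lemma fmass_inv (hP : MeasurePreserving tshift P P) : ∀ᵐ ω ∂P, fmass P ω = fmass P (tshift ω) ∧ (fmass P ω ≠ 0 → gmass P ω = 1) := by
  have h1 := fmass_eq P hP
  have hg : ∀ ω, gmass P ω ≤ 1 := fun ω => prob_le_one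
  have hle : fmass P ≤ᵐ[P] fun ω => fmass P (tshift ω) := by
    filter_upwards [h1] with ω hω
    rw [hω]
    exact mul_le_of_le_one_left (zero_le) (hg ω)
  have hIntg : ∫⁻ ω, fmass P (tshift ω) ∂P = ∫⁻ ω, fmass P ω ∂P :=
    hP.lintegral_comp (measurable_fmass P)
  have hfin : ∫⁻ ω, fmass P ω ∂P ≠ ∞ := by
    refine ((lintegral_mono (g := fun _ => 1) fun ω => prob_le_one).trans_lt ?_).ne
    simp
  have heq := ae_eq_of_ae_le_of_lintegral_le hle hfin
    ((measurable_fmass P).comp measurable_tshift).aemeasurable hIntg.le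
  filter_upwards [h1, heq] with ω h1 h2
  refine ⟨h2, fun h0 => ?_⟩
  rw [← h2] at h1
  have hlt : fmass P ω ≠ ∞ := (prob_le_one.trans_lt ENNReal.one_lt_top).ne
  exact ((ENNReal.mul_eq_right h0 hlt).1 h1.symm)
end
end SEq

namespace SEq
open ProbabilityTheory

/-- number of prediction errors -/
noncomputable def err {p : ℕ} (k : ℕ) (G : (Fin k → Fin p) → Fin p) (n : ℕ) (y : ℕ → Fin p) : ℕ :=
  ∑ j ∈ Finset.range n, if y (j + k) = G (fun i : Fin k => y (j + i)) then 0 else 1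

lemma approx_cyl {p : ℕ} (π : Measure (ℕ → Fin p)) [IsFiniteMeasure π] {H : Set (ℕ → Fin p)}
    (hH : MeasurableSet H) {ε : ℝ} (hε : 0 < ε) :
    ∃ (k : ℕ) (T : Set (ℕ → Fin p)), (∀ b b' : ℕ → Fin p, (∀ i < k, b i = b' i) → b ∈ T → b' ∈ T) ∧
      MeasurableSet T ∧ π (symmDiff H T) < ENNReal.ofReal ε := by
  have hd : π.MeasureDense (measurableCylinders fun _ : ℕ => Fin p) :=
    Measure.MeasureDense.of_generateFrom_isSetAlgebra_finite _
      ⟨empty_mem_measurableCylinders _, fun s hs => compl_mem_measurableCylinders hs,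
        fun s t hs ht => union_mem_measurableCylinders hs ht⟩ generateFrom_measurableCylinders.symm
  obtain ⟨T, hT, hlt⟩ := hd.approx H hH (measure_ne_top _ _) ε hε
  obtain ⟨s, S, hS, rfl⟩ := (mem_measurableCylinders T).1 hT
  refine ⟨s.sup id + 1, _, ?_, hd.measurable _ hT, hlt⟩
  intro b b' h hb
  rw [mem_cylinder] at hb ⊢
  convert hb using 1
  ext i
  have : (i : ℕ) ≤ s.sup id := Finset.le_sup (f := id) i.2
  simp [Finset.restrict, h i (by omega)]

section
variable {p : ℕ} [NeZero p] (P : Measure (ℤ → Fin p)) [IsProbabilityMeasure P]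

lemma predict (hP : MeasurePreserving tshift P P) (hE : P {ω | fmass P ω ≠ 0} ≠ 0) {ε : ℝ} (hε : 0 < ε) :
    ∃ k, ∃ G : (Fin k → Fin p) → Fin p,
      P.real {ω | fmass P ω ≠ 0 ∧ ω 0 ≠ G (fun i : Fin k => ω (-k + i))} ≤ ε := by
  have hp0 : (0:ℝ) < p := by exact_mod_cast Nat.pos_of_ne_zero (NeZero.ne p)
  let H : Fin p → Set (ℕ → Fin p) := fun d => {b | kap P b {y | y 0 = d} = 1}
  have hm0 : ∀ d : Fin p, MeasurableSet {y : ℕ → Fin p | y 0 = d} := fun d =>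
    measurableSet_eq_fun (measurable_pi_apply 0) measurable_const
  have hH : ∀ d, MeasurableSet (H d) := fun d =>
    measurableSet_eq_fun ((kap P).measurable_coe (hm0 d)) measurable_const
  have hdisj : ∀ b d d', b ∈ H d → b ∈ H d' → d = d' := by
    intro b d d' h h'
    by_contra hne
    have h1 : kap P b {y | y 0 = d}ᶜ = 0 := by
      rw [prob_compl_eq_zero_iff (hm0 d)]; exact h
    have h2 : kap P b {y | y 0 = d'} = 0 := by
      refine measure_mono_null ?_ h1
      intro y (hy : y 0 = d')
      change ¬ (y 0 = d)
      rw [hy]; exact fun h => hne h.symm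
    rw [show kap P b {y | y 0 = d'} = 1 from h'] at h2
    exact one_ne_zero h2
  have : IsFiniteMeasure (P.map past) := inferInstance
  choose kk T hT hTm hTl using fun d => approx_cyl (P.map past) (hH d) (div_pos hε hp0)
  let k := Finset.univ.sup kk
  have hk : ∀ d, kk d ≤ k := fun d => Finset.le_sup (f := kk) (Finset.mem_univ d)
  classical
  let ext : (Fin k → Fin p) → (ℕ → Fin p) := fun w n => if h : n < k then w (Fin.rev ⟨n, h⟩) else 0
  let G : (Fin k → Fin p) → Fin p := fun w => if h : ∃ d, ext w ∈ T d then h.choose else 0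
  refine ⟨k, G, ?_⟩
  let Bad : Set (ℤ → Fin p) := ⋃ d, past ⁻¹' (symmDiff (H d) (T d))
  have hbad : P.real Bad ≤ ε := by
    calc P.real Bad ≤ ∑ d, P.real (past ⁻¹' (symmDiff (H d) (T d))) := measureReal_iUnion_fintype_le _
      _ ≤ ∑ d : Fin p, ε / p := by
        refine Finset.sum_le_sum fun d _ => ?_
        have := hTl d
        rw [Measure.map_apply measurable_past ((hH d).symmDiff (hTm d))] at this
        exact ENNReal.toReal_le_of_le_ofReal (by positivity) this.le
      _ = ε := by simp; field_simp
  refine le_trans ?_ hbad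
  refine ENNReal.toReal_mono (measure_ne_top _ _) (measure_mono_ae ?_)
  filter_upwards [fmass_inv P hP] with ω hω
  rintro ⟨h0, hne⟩
  have hin : past ω ∈ H (ω 0) := hω.2 h0
  by_contra hnb
  have hnb' : ∀ d, past ω ∈ H d ↔ past ω ∈ T d := by
    intro d
    by_contra hc
    refine hnb (mem_iUnion.2 ⟨d, ?_⟩)
    rw [mem_preimage, Set.mem_symmDiff]
    tauto
  apply hne
  have hext : ∀ i < k, ext (fun i : Fin k => ω (-k + i)) i = past ω i := by
    intro i hi
    simp only [ext, hi, dite_true, past]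
    congr 1
    simp only [Fin.rev]
    omega
  have hw : ∀ d, ext (fun i : Fin k => ω (-k + i)) ∈ T d ↔ past ω ∈ T d := fun d =>
    ⟨hT d _ _ fun i hi => hext i (hi.trans_le (hk d)),
     hT d _ _ fun i hi => (hext i (hi.trans_le (hk d))).symm⟩
  have hex : ∃ d, ext (fun i : Fin k => ω (-k + i)) ∈ T d := ⟨ω 0, (hw _).2 ((hnb' _).1 hin)⟩
  have : G (fun i : Fin k => ω (-k + i)) = hex.choose := dif_pos hex
  rw [this]
  exact hdisj _ _ _ hin ((hnb' _).2 ((hw _).1 hex.choose_spec))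

lemma nonatomic (hP : MeasurePreserving tshift P P) {δ : ℝ} (hδ : 0 < δ)
    (hnull : ∀ k (G : (Fin k → Fin p) → Fin p),
      P (fut ⁻¹' {y | ∀ᶠ n : ℕ in atTop, (err k G n y : ℝ) ≤ δ * n}) = 0) :
    ∀ᵐ ω ∂P, fmass P ω = 0 := by
  by_contra hcon
  have hE : P {ω | fmass P ω ≠ 0} ≠ 0 := hcon
  set E : Set (ℤ → Fin p) := {ω | fmass P ω ≠ 0} with hEdef
  have hEm : MeasurableSet E := (measurableSet_eq_fun (measurable_fmass P) measurable_const).compl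
  have hEpos : 0 < P.real E := ENNReal.toReal_pos hE (measure_ne_top _ _)
  obtain ⟨k, G, hG⟩ := predict P hP hE (ε := δ / 4 * P.real E) (by positivity)
  apply hE
  classical
  let D : Set (ℤ → Fin p) := {ω | ω 0 ≠ G (fun i : Fin k => ω (-k + i))}
  have hDm : MeasurableSet D := by
    refine (measurableSet_eq_fun (measurable_pi_apply 0) ?_).compl
    exact (measurable_of_finite G).comp (measurable_pi_lambda _ fun i => measurable_pi_apply _)
  let f : (ℤ → Fin p) → ℝ := (E ∩ D).indicator 1
  have hfm : Measurable f := measurable_one.indicator (hEm.inter hDm)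
  have hfi : ∫ ω, f ω ∂P ≤ δ / 4 * P.real E := by
    rw [show ∫ ω, f ω ∂P = P.real (E ∩ D) from integral_indicator_one (hEm.inter hDm)]
    exact hG
  have hmax := maximal_ineq hP hfm ((integrable_const (1:ℝ)).indicator (hEm.inter hDm))
    (fun ω => indicator_nonneg (fun _ _ => zero_le_one) _) (δ / 2)
  have hb : P.real (bset tshift f (δ/2)) ≤ P.real E / 2 := by
    have : P.real (bset tshift f (δ/2)) * (δ/2) ≤ (P.real E / 2) * (δ / 2) := by
      refine hmax.trans (hfi.trans (le_of_eq (by ring)))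
    exact le_of_mul_le_mul_right this (by positivity)
  have hinv : ∀ᵐ ω ∂P, ∀ n, tshift^[n] ω ∈ E ↔ ω ∈ E := by
    rw [ae_all_iff]
    intro n
    induction n with
    | zero => simp
    | succ n ih =>
      have h2 := (hP.iterate n).quasiMeasurePreserving.ae (fmass_inv P hP)
      filter_upwards [ih, h2] with ω h3 h4
      rw [← h3, Function.iterate_succ_apply']
      simp only [hEdef, ne_eq, mem_ofPred_eq, ← h4.1]
  have hsub : E ≤ᵐ[P] (bset tshift f (δ/2) : Set _) := by
    have hk := (hP.iterate k).measure_preimage (s := fut ⁻¹' {y | ∀ᶠ n : ℕ in atTop, (err k G n y : ℝ) ≤ δ * n})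
    filter_upwards [hinv, compl_mem_ae_iff.2 (hnull k G)] with ω h1 h2 (hω : ω ∈ E)
    by_contra hnb
    apply h2
    change ∀ᶠ n : ℕ in atTop, (err k G n (fut ω) : ℝ) ≤ δ * n
    have hnb2 : tshift^[k] ω ∉ bset tshift f (δ/2) := by
      have : ∀ k, tshift^[k] ω ∈ bset tshift f (δ/2) ↔ ω ∈ bset tshift f (δ/2) := by
        intro k
        induction k with
        | zero => simp
        | succ k ih => rw [Function.iterate_succ_apply', bset_invariant, ih]
      rw [this]; exact hnb
    have hnb3 : ∀ n : ℕ, ∀ᶠ N : ℕ in atTop,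
        birkhoffSum tshift f N (tshift^[k] ω) ≤ (δ/2 + 1 / ((n : ℝ) + 1)) * N := by
      intro n
      by_contra hc
      apply hnb2
      refine ⟨n, ?_⟩
      intro hc'
      exact hc (hc'.mono fun N hN => not_lt.1 hN)
    obtain ⟨n, hn⟩ := exists_nat_one_div_lt (half_pos hδ)
    filter_upwards [hnb3 n] with N hN
    have e : (err k G N (fut ω) : ℝ) = birkhoffSum tshift f N (tshift^[k] ω) := by
      unfold err birkhoffSum
      push_cast
      refine Finset.sum_congr rfl fun j _ => ?_
      rw [← Function.iterate_add_apply]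
      have hmem : tshift^[j + k] ω ∈ E := (h1 _).2 hω
      have hD : tshift^[j + k] ω ∈ D ↔ ¬ (fut ω (j + k) = G (fun i : Fin k => fut ω (j + i))) := by
        have : (fun i : Fin k => (tshift^[j + k] ω) (-k + i)) = (fun i : Fin k => fut ω (j + i)) := by
          ext i
          rw [iterate_tshift]; simp only [fut]; congr 2; push_cast; ring
        change ((tshift^[j + k] ω) 0 ≠ G (fun i : Fin k => (tshift^[j + k] ω) (-k + i))) ↔ _
        rw [this, iterate_tshift]
        simp [fut]
      by_cases hd : fut ω (j + k) = G (fun i : Fin k => fut ω (j + i))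
      · rw [if_pos hd]
        have : tshift^[j + k] ω ∉ E ∩ D := fun h => hD.1 h.2 hd
        simp only [f]
        rw [indicator_of_notMem this]
      · rw [if_neg hd]
        have : tshift^[j + k] ω ∈ E ∩ D := ⟨hmem, hD.2 hd⟩
        simp only [f]
        rw [indicator_of_mem this]; rfl
    rw [e]
    refine hN.trans ?_
    have : (0:ℝ) ≤ N := Nat.cast_nonneg _
    nlinarith
  have h1 : P.real E ≤ P.real (bset tshift f (δ/2)) :=
    ENNReal.toReal_mono (measure_ne_top _ _) (measure_mono_ae hsub)
  linarith
end
end SEq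

namespace SEq

/-- extend a finite word by zeros -/
def extw {p : ℕ} [NeZero p] {n : ℕ} (w : Fin n → Fin p) : ℕ → Fin p :=
  fun i => if h : i < n then w ⟨i, h⟩ else 0

lemma err_congr {p k n : ℕ} {G : (Fin k → Fin p) → Fin p} {y y' : ℕ → Fin p}
    (h : ∀ i < k + n, y i = y' i) : err k G n y = err k G n y' := by
  unfold err
  refine Finset.sum_congr rfl fun j hj => ?_
  rw [Finset.mem_range] at hj
  rw [h (j + k) (by omega), show (fun i : Fin k => y (j + i)) = fun i : Fin k => y' (j + i) from
    funext fun i => h _ (by omega)]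

lemma words_sum {p k : ℕ} [NeZero p] (G : (Fin k → Fin p) → Fin p) {l : ℝ} (hl : 0 ≤ l) (n : ℕ) :
    ∑ w : Fin (k + n) → Fin p, l ^ (err k G n (extw w)) ≤ (p:ℝ) ^ k * (1 + p * l) ^ n := by
  induction n with
  | zero => simp [err]
  | succ n ih =>
    have e := (Fin.snocEquiv (n := k + n) (fun _ => Fin p)).sum_comp
      (fun w : Fin (k + (n + 1)) → Fin p => l ^ (err k G (n+1) (extw w)))
    refine (le_of_eq (Eq.symm e)).trans ?_
    rw [Fintype.sum_prod_type_right]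
    have key : ∀ w : Fin (k + n) → Fin p,
        ∑ d : Fin p, l ^ (err k G (n+1) (extw ((Fin.snocEquiv (n := k + n) (fun _ => Fin p)) (d, w)))) ≤
          l ^ (err k G n (extw w)) * (1 + p * l) := by
      intro w
      let g := G (fun i : Fin k => extw w (n + i))
      have h1 : ∀ d : Fin p, l ^ (err k G (n+1) (extw ((Fin.snocEquiv (n := k + n) (fun _ => Fin p)) (d, w))))
          ≤ l ^ (err k G n (extw w)) * ((if d = g then 1 else 0) + l) := by
        intro d
        set w' : Fin (k + n + 1) → Fin p := (Fin.snocEquiv (n := k + n) (fun _ => Fin p)) (d, w) with hw'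
        have hagree : ∀ i < k + n, extw w' i = extw w i := by
          intro i hi
          simp only [extw, hi, dif_pos, show i < k + n + 1 by omega]
          rw [hw']
          exact Fin.snoc_castSucc (α := fun _ => Fin p) d w ⟨i, hi⟩
        have hlast : extw w' (n + k) = d := by
          simp only [extw, show n + k < k + n + 1 by omega, dif_pos]
          rw [hw', show (⟨n + k, by omega⟩ : Fin (k + n + 1)) = Fin.last _ from Fin.ext (by simp; omega)]
          exact Fin.snoc_last (α := fun _ => Fin p) d w
        have herr : err k G (n+1) (extw w') = err k G n (extw w) + if d = g then 0 else 1 := by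
          rw [err, Finset.sum_range_succ, ← err, err_congr hagree, hlast]
          congr 2
          have : (fun i : Fin k => extw w' (n + i)) = fun i : Fin k => extw w (n + i) :=
            funext fun i => hagree _ (by omega)
          simp only [g, this]
        change l ^ (err k G (n+1) (extw w')) ≤ _
        rw [herr, pow_add]
        refine mul_le_mul_of_nonneg_left ?_ (by positivity)
        split_ifs <;> simp [hl]
      refine (Finset.sum_le_sum fun d _ => h1 d).trans (le_of_eq ?_)
      rw [← Finset.mul_sum, Finset.sum_add_distrib]
      simp
    refine (Finset.sum_le_sum fun w _ => key w).trans ?_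
    rw [← Finset.sum_mul, pow_succ, ← mul_assoc]
    exact mul_le_mul_of_nonneg_right ih (by positivity)

/-- digits to circle -/
noncomputable def cval {p : ℕ} (y : ℕ → Fin p) : UnitAddCircle := ((Real.ofDigits y : ℝ) : UnitAddCircle)

lemma dist_cval {p n : ℕ} {y y' : ℕ → Fin p} (h : ∀ i < n, y i = y' i) :
    dist (cval y) (cval y') ≤ ((p:ℝ) ^ n)⁻¹ := by
  refine le_trans ?_ (Real.abs_ofDigits_sub_ofDigits_le h)
  rw [dist_eq_norm]
  unfold cval
  rw [← AddCircle.coe_sub]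
  exact QuotientAddGroup.norm_mk_le_norm

lemma dim_err {p : ℕ} (hp : 2 ≤ p) {s : ℝ} (hs : 0 < s) : ∃ δ : ℝ, 0 < δ ∧
    ∀ k (G : (Fin k → Fin p) → Fin p),
    dimH (cval '' {y | ∀ᶠ n : ℕ in atTop, (err k G n y : ℝ) ≤ δ * n}) ≤ ENNReal.ofReal s := by
  have : NeZero p := ⟨by omega⟩
  have hp0 : (0:ℝ) < p := by positivity
  have hp1 : (1:ℝ) < p := by exact_mod_cast hp
  set c : ℝ := (p:ℝ) ^ (s/3) with hc
  have hc1 : 1 < c := Real.one_lt_rpow hp1 (by positivity)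
  set l : ℝ := min (1/2) ((c-1)/p) with hl
  have hl0 : 0 < l := lt_min (by norm_num) (div_pos (by linarith) hp0)
  have hl1 : l < 1 := (min_le_left _ _).trans_lt (by norm_num)
  have hlc : 1 + p * l ≤ c := by
    have : l ≤ (c-1)/p := min_le_right _ _
    rw [le_div_iff₀ hp0] at this
    linarith
  have hlog : Real.log l < 0 := Real.log_neg hl0 hl1
  have hlogc : 0 < Real.log c := Real.log_pos hc1
  refine ⟨Real.log c / (-Real.log l), div_pos hlogc (by linarith), fun k G => ?_⟩
  set δ := Real.log c / (-Real.log l) with hδ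
  have hw : ∀ n e : ℕ, (e:ℝ) ≤ δ * n → 1 ≤ l ^ e * c ^ n := by
    intro n e he
    rw [← Real.log_nonneg_iff (by positivity), Real.log_mul (by positivity) (by positivity),
      Real.log_pow, Real.log_pow]
    have h1 : δ * n * Real.log l ≤ e * Real.log l := mul_le_mul_of_nonpos_right he hlog.le
    have h2 : δ * n * Real.log l = - (n * Real.log c) := by
      have := hlog.ne
      rw [hδ]; field_simp
    linarith
  have hU : {y : ℕ → Fin p | ∀ᶠ n : ℕ in atTop, (err k G n y : ℝ) ≤ δ * n} =
      ⋃ N : ℕ, {y | ∀ n ≥ N, (err k G n y : ℝ) ≤ δ * n} := by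
    ext y
    simp only [mem_ofPred_eq, mem_iUnion, eventually_atTop]
  rw [hU, image_iUnion, dimH_iUnion]
  refine iSup_le fun N => ?_
  have hsc : ENNReal.ofReal s = ((s.toNNReal : NNReal) : ℝ≥0∞) := rfl
  rw [hsc]
  apply dimH_le_of_hausdorffMeasure_ne_top
  rw [Real.coe_toNNReal _ hs.le]
  let t : (n : ℕ) → (Fin (k + n) → Fin p) → Set UnitAddCircle := fun n w =>
    cval '' {y | (∀ i < k + n, y i = extw w i) ∧ (err k G n y : ℝ) ≤ δ * n}
  have hdiam : ∀ n w, Metric.ediam (t n w) ≤ ENNReal.ofReal (((p:ℝ) ^ n)⁻¹) := by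
    intro n w
    refine Metric.ediam_le ?_
    rintro _ ⟨y, hy, rfl⟩ _ ⟨y', hy', rfl⟩
    rw [edist_dist]
    refine ENNReal.ofReal_le_ofReal (dist_cval fun i hi => ?_)
    rw [hy.1 i (by omega), hy'.1 i (by omega)]
  have hr : Tendsto (fun n : ℕ => ENNReal.ofReal (((p:ℝ) ^ n)⁻¹)) atTop (𝓝 0) := by
    rw [← ENNReal.ofReal_zero]
    refine ENNReal.tendsto_ofReal ?_
    simp_rw [← inv_pow]
    exact tendsto_pow_atTop_nhds_zero_of_lt_one (by positivity) (inv_lt_one_of_one_lt₀ hp1)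
  have hle := Measure.hausdorffMeasure_le_liminf_sum s (cval '' {y : ℕ → Fin p | ∀ n ≥ N, (err k G n y : ℝ) ≤ δ * n})
    (l := atTop) _ hr t (Eventually.of_forall hdiam) (by
      filter_upwards [eventually_ge_atTop N] with n hn
      rintro _ ⟨y, hy, rfl⟩
      refine mem_iUnion.2 ⟨fun i => y i, y, ⟨fun i hi => ?_, hy n hn⟩, rfl⟩
      simp [extw, hi])
  have hbound : ∀ n, ∑ w, Metric.ediam (t n w) ^ s ≤ ENNReal.ofReal ((p:ℝ)^k * (c⁻¹) ^ n) := by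
    intro n
    have h1 : ∀ w, Metric.ediam (t n w) ^ s ≤
        ENNReal.ofReal (l ^ (err k G n (extw w)) * c ^ n * ((c⁻¹)^3)^n) := by
      intro w
      rcases (t n w).eq_empty_or_nonempty with he | ⟨_, y, hy, rfl⟩
      · rw [he, Metric.ediam_empty, ENNReal.zero_rpow_of_pos hs]; exact zero_le
      · have h2 := hw n _ hy.2
        rw [err_congr hy.1] at h2
        calc Metric.ediam (t n w) ^ s ≤ (ENNReal.ofReal (((p:ℝ) ^ n)⁻¹)) ^ s :=
              ENNReal.rpow_le_rpow (hdiam n w) hs.le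
          _ = ENNReal.ofReal ((((p:ℝ) ^ n)⁻¹) ^ s) := ENNReal.ofReal_rpow_of_nonneg (by positivity) hs.le
          _ ≤ _ := by
            refine ENNReal.ofReal_le_ofReal ?_
            have h3 : (((p:ℝ) ^ n)⁻¹) ^ s = ((c⁻¹)^3)^n := by
              rw [Real.inv_rpow (by positivity), inv_pow, inv_pow, hc]
              congr 1
              rw [← Real.rpow_natCast, ← Real.rpow_natCast, ← Real.rpow_natCast, ← Real.rpow_mul hp0.le,
                ← Real.rpow_mul hp0.le, ← Real.rpow_mul hp0.le]
              congr 1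
              push_cast; ring
            rw [h3]
            exact le_mul_of_one_le_left (by positivity) h2
    refine (Finset.sum_le_sum fun w _ => h1 w).trans ?_
    rw [← ENNReal.ofReal_sum_of_nonneg (fun w _ => by positivity)]
    refine ENNReal.ofReal_le_ofReal ?_
    simp_rw [mul_assoc]
    rw [← Finset.sum_mul]
    have h4 := words_sum G hl0.le n
    have h5 : (1 + p * l) ^ n ≤ c ^ n := pow_le_pow_left₀ (by positivity) hlc n
    calc _ ≤ ((p:ℝ)^k * c ^ n) * (c ^ n * ((c⁻¹)^3)^n) := by
          refine mul_le_mul_of_nonneg_right (h4.trans ?_) (by positivity)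
          exact mul_le_mul_of_nonneg_left h5 (by positivity)
      _ = (p:ℝ)^k * (c * c * (c⁻¹)^3)^n := by rw [mul_pow, mul_pow]; ring
      _ = _ := by congr 2; field_simp
  have hlim : Tendsto (fun n : ℕ => ENNReal.ofReal ((p:ℝ)^k * (c⁻¹) ^ n)) atTop (𝓝 0) := by
    rw [← ENNReal.ofReal_zero]
    refine ENNReal.tendsto_ofReal ?_
    rw [← mul_zero ((p:ℝ)^k)]
    exact (tendsto_pow_atTop_nhds_zero_of_lt_one (by positivity) (inv_lt_one_of_one_lt₀ hc1)).const_mul _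
  have := hle.trans (liminf_le_liminf (Eventually.of_forall hbound))
  rw [hlim.liminf_eq] at this
  exact (this.trans_lt (by simp)).ne
end SEq

namespace SEq

/-- representative in `[0,1)` -/
noncomputable def rep (s : UnitAddCircle) : ℝ := (AddCircle.equivIco 1 0 s : ℝ)

lemma rep_coe (x : ℝ) : rep (x : UnitAddCircle) = Int.fract x := by
  have := AddCircle.coe_equivIco_mk_apply (1:ℝ) x
  rw [div_one, mul_one] at this
  exact this

lemma coe_rep (s : UnitAddCircle) : ((rep s : ℝ) : UnitAddCircle) = s := AddCircle.coe_equivIco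

lemma rep_nonneg (s : UnitAddCircle) : 0 ≤ rep s := (AddCircle.equivIco 1 0 s).2.1
lemma rep_lt_one (s : UnitAddCircle) : rep s < 1 := by
  have := (AddCircle.equivIco (1:ℝ) 0 s).2.2
  unfold rep; linarith

lemma measurable_rep : Measurable rep :=
  measurable_subtype_coe.comp (AddCircle.measurableEquivIco 1 0).measurable

lemma addOrderOf_irr {α : ℝ} (hα : Irrational α) : addOrderOf (α : UnitAddCircle) = 0 := by
  by_contra h
  have hpos : 0 < addOrderOf (α : UnitAddCircle) := Nat.pos_of_ne_zero h
  obtain ⟨m, -, -, hm⟩ := (AddCircle.addOrderOf_eq_pos_iff hpos).1 rfl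
  have h2 : (((m:ℝ) / (addOrderOf (α : UnitAddCircle):ℝ) * 1 : ℝ) : UnitAddCircle) = (α : UnitAddCircle) := hm
  have h3 := congrArg rep h2
  rw [rep_coe, rep_coe] at h3
  have : α = ((⌊α⌋ : ℚ) + (m:ℚ) / (addOrderOf (α : UnitAddCircle):ℚ) -
      (⌊(m:ℝ) / (addOrderOf (α : UnitAddCircle):ℝ) * 1⌋ : ℚ) : ℚ) := by
    push_cast
    unfold Int.fract at h3
    linarith
  exact hα ⟨_, this.symm⟩

section
variable {Ω : Type*} [MeasurableSpace Ω] {P : Measure Ω} [IsProbabilityMeasure P] {σ : Ω → Ω}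

/-- skew product -/
noncomputable def skewR (α : ℝ) (σ : Ω → Ω) (z : UnitAddCircle × Ω) : UnitAddCircle × Ω :=
  (z.1 + (α : UnitAddCircle), σ^[⌊rep z.1 + α⌋₊] z.2)

lemma measurable_iter (hσ : Measurable σ) {γ : Type*} [MeasurableSpace γ] {n : γ → ℕ} (hn : Measurable n) :
    Measurable (fun z : γ × Ω => σ^[n z.1] z.2) := by
  have : Measurable (fun z : ℕ × Ω => σ^[z.1] z.2) :=
    measurable_from_prod_countable_right fun k => hσ.iterate k
  exact this.comp ((hn.comp measurable_fst).prodMk measurable_snd)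

lemma skewR_mp (hσ : MeasurePreserving σ P P) (α : ℝ) :
    MeasurePreserving (skewR α σ) ((volume : Measure UnitAddCircle).prod P)
      ((volume : Measure UnitAddCircle).prod P) := by
  refine MeasurePreserving.skew_product (f := fun s : UnitAddCircle => s + (α : UnitAddCircle))
    (g := fun s ω => σ^[⌊rep s + α⌋₊] ω) (measurePreserving_add_right volume _) ?_ ?_
  · exact measurable_iter hσ.measurable (Nat.measurable_floor.comp (measurable_rep.add_const α))
  · exact Eventually.of_forall fun s => (hσ.iterate _).map_eq

lemma skewR_iter {α : ℝ} (hα : 0 < α) (σ : Ω → Ω) {s : ℝ} (hs : 0 ≤ s) (hs1 : s < 1) (ω : Ω) (i : ℕ) :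
    (skewR α σ)^[i] ((s : UnitAddCircle), ω) =
      (((s + i * α : ℝ) : UnitAddCircle), σ^[⌊s + i * α⌋₊] ω) := by
  induction i with
  | zero =>
    have : ⌊s⌋₊ = 0 := Nat.floor_eq_zero.2 hs1
    simp [this]
  | succ i ih =>
    rw [Function.iterate_succ_apply', ih]
    unfold skewR
    simp only [Prod.mk.injEq]
    have hx : 0 ≤ s + i * α := by positivity
    refine ⟨?_, ?_⟩
    · rw [← AddCircle.coe_add]; congr 1; push_cast; ring
    · rw [← Function.iterate_add_apply, rep_coe]
      congr 2
      have h1 : s + ((i+1 : ℕ):ℝ) * α = (Int.fract (s + i*α) + α) + (⌊s + i*α⌋₊ : ℕ) := by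
        have := Int.fract_add_floor (s + i*α)
        have h2 : ((⌊s + i*α⌋₊ : ℕ) : ℝ) = (⌊s + i*α⌋ : ℝ) := natCast_floor_eq_intCast_floor hx
        push_cast
        rw [h2]
        linarith
      rw [h1, Nat.floor_add_natCast (by have := Int.fract_nonneg (s+i*α); positivity)]

/-- the exceptional event -/
def evt (σ : Ω → Ω) (α : ℝ) (F : ℝ → Ω → ℝ) (t : ℝ) : Set Ω :=
  {ω | ∃ᶠ N : ℕ in atTop, t * N < ∑ i ∈ Finset.range N, F (Int.fract (i * α)) (σ^[⌊i * α⌋₊] ω)}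

lemma skew_aux (hσ : MeasurePreserving σ P P) {α : ℝ} (hα : Irrational α) (hα0 : 0 < α)
    {F : ℝ → Ω → ℝ} (hF0 : ∀ θ ω, 0 ≤ F θ ω) (hF1 : ∀ θ ω, F θ ω ≤ 1) (hFm : ∀ θ, Measurable (F θ))
    (hFc : ∀ ω, Continuous fun θ => F θ ω) {L : ℝ} (hL0 : 0 ≤ L)
    (hL : ∀ ω, ∀ θ ∈ Icc (0:ℝ) 1, ∀ θ' ∈ Icc (0:ℝ) 1, |F θ ω - F θ' ω| ≤ L * |θ - θ'|)
    {t : ℝ} (ht : 0 < t) {η : ℝ} (hη : 0 < η) (hη1 : η < 1) :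
    P.real (evt σ α F t) * (t / 2) ≤ (∫ θ in Ioc (0:ℝ) 1, ∫ ω, F θ ω ∂P) + L * η + η := by
  have hFu : Measurable (Function.uncurry F) := measurable_uncurry_of_continuous_of_measurable hFc hFm
  let V : Measure (UnitAddCircle × Ω) := (volume : Measure UnitAddCircle).prod P
  let Fp : UnitAddCircle × Ω → ℝ := fun z => F (rep z.1) z.2 + L * η + (Ico 0 η).indicator 1 (rep z.1)
  have hind : Measurable (fun x : ℝ => (Ico 0 η).indicator (1 : ℝ → ℝ) x) :=
    measurable_one.indicator measurableSet_Ico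
  have hFpm : Measurable Fp :=
    ((hFu.comp ((measurable_rep.comp measurable_fst).prodMk measurable_snd)).add_const _).add
      (hind.comp (measurable_rep.comp measurable_fst))
  have hi0 : ∀ x, 0 ≤ (Ico 0 η).indicator (1 : ℝ → ℝ) x := fun x => indicator_nonneg (fun _ _ => zero_le_one) _
  have hi1 : ∀ x, (Ico 0 η).indicator (1 : ℝ → ℝ) x ≤ 1 := fun x =>
    indicator_le_self' (fun _ _ => zero_le_one) _
  have hFp0 : ∀ z, 0 ≤ Fp z := fun z => add_nonneg (add_nonneg (hF0 _ _) (by positivity)) (hi0 _)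
  have hFpi : Integrable Fp V := by
    refine Integrable.of_bound hFpm.aestronglyMeasurable (1 + L * η + 1) (Eventually.of_forall fun z => ?_)
    rw [Real.norm_of_nonneg (hFp0 z)]
    exact add_le_add (add_le_add (hF1 _ _) le_rfl) (hi1 _)
  have hR := skewR_mp hσ α
  have hmax := maximal_ineq hR hFpm hFpi hFp0 (t/2)
  set B := bset (skewR α σ) Fp (t/2) with hB
  have hBm : MeasurableSet B := bset_measurable hR.measurable hFpm _
  let b : UnitAddCircle → ℝ≥0∞ := fun s => P (Prod.mk s ⁻¹' B)
  have hbm : Measurable b := measurable_measure_prodMk_left hBm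
  have hbinv : ∀ s, b (s + (α : UnitAddCircle)) = b s := by
    intro s
    have h1 : Prod.mk s ⁻¹' B = (σ^[⌊rep s + α⌋₊]) ⁻¹' (Prod.mk (s + (α : UnitAddCircle)) ⁻¹' B) := by
      ext ω
      exact (bset_invariant (skewR α σ) Fp (t/2) (s, ω)).symm
    simp only [b]
    rw [h1, (hσ.iterate _).measure_preimage (measurable_prodMk_left hBm).nullMeasurableSet]
  obtain ⟨c, hc⟩ := Ergodic.ae_eq_const_of_ae_eq_comp_ae
    (AddCircle.ergodic_add_right.2 (addOrderOf_irr hα)) hbm.aestronglyMeasurable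
    (Eventually.of_forall hbinv)
  have hVB : V B = c := by
    change ((volume : Measure UnitAddCircle).prod P) B = c
    rw [Measure.prod_apply hBm, lintegral_congr_ae hc]
    simp
  have hsub : ∀ s ∈ Ico 0 η, evt σ α F t ⊆ Prod.mk (s : UnitAddCircle) ⁻¹' B := by
    intro s hs ω hω
    obtain ⟨n, hn⟩ := exists_nat_one_div_lt (half_pos ht)
    refine ⟨n, hω.mono fun N hN => ?_⟩
    have hN0 : (0:ℝ) ≤ N := Nat.cast_nonneg _
    refine lt_of_le_of_lt (b := t * N) (by nlinarith) (hN.trans_le ?_)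
    unfold birkhoffSum
    refine Finset.sum_le_sum fun i _ => ?_
    rw [skewR_iter hα0 σ hs.1 (hs.2.trans hη1)]
    simp only [Fp, rep_coe]
    have hia : 0 ≤ (i:ℝ) * α := by positivity
    have hf0 := Int.fract_nonneg ((i:ℝ) * α)
    have hf1 := Int.fract_lt_one ((i:ℝ) * α)
    rcases lt_or_ge (Int.fract ((i:ℝ) * α) + s) 1 with h | h
    · have e1 : ⌊s + i * α⌋ = ⌊i * α⌋ := by
        rw [Int.floor_eq_iff]
        have := Int.fract_add_floor ((i:ℝ) * α)
        constructor <;> linarith [hs.1]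
      have e2 : ⌊s + i * α⌋₊ = ⌊i * α⌋₊ := by
        rw [← Int.floor_toNat, ← Int.floor_toNat, e1]
      have e3 : Int.fract (s + i * α) = Int.fract (i * α) + s := by
        unfold Int.fract; rw [e1]; ring
      rw [e2, e3]
      have h4 := hL (σ^[⌊i * α⌋₊] ω) (Int.fract (i*α)) ⟨hf0, hf1.le⟩ (Int.fract (i * α) + s)
        ⟨by linarith [hs.1], h.le⟩
      have h5 : |Int.fract (i * α) - (Int.fract (i * α) + s)| ≤ η := by
        rw [sub_add_cancel_left, abs_neg, abs_of_nonneg hs.1]; exact hs.2.le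
      have h6 := (abs_le.1 (h4.trans (mul_le_mul_of_nonneg_left h5 hL0))).2
      linarith [hi0 (Int.fract (i * α) + s)]
    · have e1 : ⌊s + i * α⌋ = ⌊i * α⌋ + 1 := by
        rw [Int.floor_eq_iff]
        have := Int.fract_add_floor ((i:ℝ) * α)
        push_cast
        constructor <;> linarith [hs.1, hs.2]
      have e3 : Int.fract (s + i * α) = Int.fract (i * α) + s - 1 := by
        unfold Int.fract; rw [e1]; push_cast; ring
      have hm : Int.fract (s + i * α) ∈ Ico 0 η := by
        rw [e3]; constructor <;> linarith [hs.2]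
      rw [indicator_of_mem hm, Pi.one_apply]
      have := hF1 (Int.fract (i * α)) (σ^[⌊i * α⌋₊] ω)
      have := hF0 (Int.fract (s + i * α)) (σ^[⌊s + i * α⌋₊] ω)
      have : 0 ≤ L * η := by positivity
      linarith
  have hex : ∃ s ∈ Ico 0 η, b (s : UnitAddCircle) = c := by
    have h1 : ∀ᵐ x : ℝ ∂(volume.restrict (Ioc (0:ℝ) (0+1))), b (x : UnitAddCircle) = c :=
      (UnitAddCircle.measurePreserving_mk 0).quasiMeasurePreserving.ae hc
    have h2 : ∀ᵐ x : ℝ ∂(volume.restrict (Ioo (0:ℝ) η)), b (x : UnitAddCircle) = c :=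
      ae_restrict_of_ae_restrict_of_subset (show Ioo (0:ℝ) η ⊆ Ioc 0 (0+1) from fun x hx => ⟨hx.1, by linarith [hx.2]⟩) h1
    have h3 : ∀ᵐ x : ℝ ∂(volume.restrict (Ioo (0:ℝ) η)), x ∈ Ioo 0 η := ae_restrict_mem measurableSet_Ioo
    have : NeBot (ae (volume.restrict (Ioo (0:ℝ) η))) := by
      rw [ae_neBot]
      intro h
      have := congrArg (fun m => m univ) h
      simp at this
      linarith
    obtain ⟨x, hx, hx2⟩ := (h2.and h3).exists
    exact ⟨x, ⟨hx2.1.le, hx2.2⟩, hx⟩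
  have hle : P.real (evt σ α F t) ≤ V.real B := by
    obtain ⟨s, hs, hbs⟩ := hex
    refine ENNReal.toReal_mono (measure_ne_top _ _) ?_
    rw [hVB, ← hbs]
    exact measure_mono (hsub s hs)
  have hIntg : ∫ z, Fp z ∂V = (∫ θ in Ioc (0:ℝ) 1, ∫ ω, F θ ω ∂P) + L * η + η := by
    have h1 : ∫ z, Fp z ∂V = ∫ s : UnitAddCircle, ((∫ ω, F (rep s) ω ∂P) + L * η + (Ico 0 η).indicator 1 (rep s)) := by
      rw [integral_prod _ hFpi]
      congr 1
      ext s
      simp only [Fp]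
      have i1 : Integrable (F (rep s)) P := Integrable.of_bound (hFm _).aestronglyMeasurable 1
        (Eventually.of_forall fun ω => by rw [Real.norm_of_nonneg (hF0 _ _)]; exact hF1 _ _)
      have i3 : Integrable (fun ω => F (rep s) ω + L * η) P := i1.add (integrable_const _)
      rw [integral_add i3 (integrable_const _), integral_add i1 (integrable_const _)]
      simp
    rw [h1, ← UnitAddCircle.integral_preimage 0]
    simp only [zero_add, rep_coe]
    have h2 : ∫ x in Ioc (0:ℝ) 1, ((∫ ω, F (Int.fract x) ω ∂P) + L * η + (Ico 0 η).indicator 1 (Int.fract x)) =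
        ∫ x in Ioc (0:ℝ) 1, ((∫ ω, F x ω ∂P) + L * η + (Ico 0 η).indicator 1 x) := by
      rw [← integral_Ico_eq_integral_Ioc, ← integral_Ico_eq_integral_Ioc]
      refine setIntegral_congr_fun measurableSet_Ico fun x hx => ?_
      simp only [Int.fract_eq_self.2 hx]
    rw [h2]
    have i1 : Integrable (fun x => ∫ ω, F x ω ∂P) (volume.restrict (Ioc (0:ℝ) 1)) := by
      refine Integrable.of_bound
        (hFu.stronglyMeasurable.integral_prod_right).aestronglyMeasurable 1
        (Eventually.of_forall fun x => ?_)
      refine (norm_integral_le_of_norm_le_const (C := 1) (Eventually.of_forall fun ω => by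
        rw [Real.norm_of_nonneg (hF0 _ _)]; exact hF1 _ _)).trans (by simp)
    have i2 : Integrable (fun x => (Ico 0 η).indicator (1 : ℝ → ℝ) x) (volume.restrict (Ioc (0:ℝ) 1)) :=
      Integrable.of_bound hind.aestronglyMeasurable 1 (Eventually.of_forall fun x => by
        rw [Real.norm_of_nonneg (hi0 _)]; exact hi1 _)
    have i3 : Integrable (fun x => (∫ ω, F x ω ∂P) + L * η) (volume.restrict (Ioc (0:ℝ) 1)) :=
      i1.add (integrable_const _)
    rw [integral_add i3 i2, integral_add i1 (integrable_const _)]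
    have h3 : ∫ x in Ioc (0:ℝ) 1, (Ico 0 η).indicator (1 : ℝ → ℝ) x = η := by
      rw [integral_indicator_one measurableSet_Ico, measureReal_restrict_apply measurableSet_Ico]
      have : Ico 0 η ∩ Ioc 0 1 = Ioo 0 η := by
        ext x; simp only [mem_inter_iff, mem_Ico, mem_Ioc, mem_Ioo]
        constructor
        · rintro ⟨⟨_, h⟩, h', _⟩; exact ⟨h', h⟩
        · rintro ⟨h, h'⟩; exact ⟨⟨h.le, h'⟩, h, by linarith⟩
      rw [this]
      simp [hη.le]
    rw [h3]
    simp
  rw [← hIntg]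
  exact (mul_le_mul_of_nonneg_right hle (by positivity)).trans hmax

lemma skew_bound (hσ : MeasurePreserving σ P P) {α : ℝ} (hα : Irrational α) (hα0 : 0 < α)
    {F : ℝ → Ω → ℝ} (hF0 : ∀ θ ω, 0 ≤ F θ ω) (hF1 : ∀ θ ω, F θ ω ≤ 1) (hFm : ∀ θ, Measurable (F θ))
    (hFc : ∀ ω, Continuous fun θ => F θ ω) {L : ℝ} (hL0 : 0 ≤ L)
    (hL : ∀ ω, ∀ θ ∈ Icc (0:ℝ) 1, ∀ θ' ∈ Icc (0:ℝ) 1, |F θ ω - F θ' ω| ≤ L * |θ - θ'|)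
    {t : ℝ} (ht : 0 < t) :
    P.real (evt σ α F t) * (t / 2) ≤ ∫ θ in Ioc (0:ℝ) 1, ∫ ω, F θ ω ∂P := by
  refine le_of_forall_pos_le_add fun ε hε => ?_
  have h := skew_aux hσ hα hα0 hF0 hF1 hFm hFc hL0 hL ht (η := min (1/2) (ε / (L + 1)))
    (lt_min (by norm_num) (by positivity)) ((min_le_left _ _).trans_lt (by norm_num))
  have h2 : min (1/2) (ε / (L + 1)) ≤ ε / (L+1) := min_le_right _ _
  rw [le_div_iff₀ (by positivity)] at h2
  linarith
end
end SEq

namespace SEq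
open ProbabilityTheory

/-- the additive character -/
noncomputable def ee (t : ℝ) : ℂ := Complex.exp ((2 * Real.pi * t : ℝ) * Complex.I)

lemma norm_ee (t : ℝ) : ‖ee t‖ = 1 := Complex.norm_exp_ofReal_mul_I _
lemma ee_add (s t : ℝ) : ee (s + t) = ee s * ee t := by
  unfold ee; rw [← Complex.exp_add]; congr 1; push_cast; ring
lemma ee_zero : ee 0 = 1 := by simp [ee]
lemma ee_neg (t : ℝ) : ee (-t) = (starRingEnd ℂ) (ee t) := by
  unfold ee
  rw [← Complex.exp_conj]
  congr 1
  rw [map_mul, Complex.conj_ofReal, Complex.conj_I]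
  push_cast
  ring
lemma ee_sub (s t : ℝ) : ee (s - t) = ee s * (starRingEnd ℂ) (ee t) := by
  rw [sub_eq_add_neg, ee_add, ee_neg]
lemma continuous_ee : Continuous ee := by unfold ee; fun_prop
lemma ee_int (n : ℤ) : ee n = 1 := by
  unfold ee
  rw [Complex.exp_eq_one_iff]
  exact ⟨n, by push_cast; ring⟩
lemma norm_ee_sub (s t : ℝ) : ‖ee s - ee t‖ ≤ 2 * Real.pi * |s - t| := by
  have h : ee s - ee t = ee t * (ee (s - t) - 1) := by
    rw [mul_sub, ← ee_add]; simp
  rw [h, norm_mul, norm_ee, one_mul]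
  unfold ee
  rw [mul_comm (_ : ℂ) Complex.I]
  refine Real.norm_exp_I_mul_ofReal_sub_one_le.trans ?_
  rw [Real.norm_eq_abs, abs_mul, abs_of_pos (by positivity)]

lemma psi_tendsto {p : ℕ} (hp : 2 ≤ p) :
    Tendsto (fun A : ℝ => ∫ θ in Ioc (0:ℝ) 1, ee (A * (p:ℝ) ^ θ)) (cocompact ℝ) (𝓝 0) := by
  have hp0 : (0:ℝ) < p := by positivity
  have hp1 : (1:ℝ) < p := by exact_mod_cast hp
  have hlog : 0 < Real.log p := Real.log_pos hp1
  let G : ℝ → ℂ := (Ioc (1:ℝ) p).indicator fun u => ((u * Real.log p)⁻¹ : ℝ)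
  have h1 := Real.tendsto_integral_exp_smul_cocompact G
  have h2 := h1.comp (Homeomorph.neg ℝ).isClosedEmbedding.tendsto_cocompact
  refine h2.congr fun A => ?_
  simp only [Function.comp_apply, Homeomorph.coe_neg]
  have e1 : ∀ v : ℝ, (Real.fourierChar (-(v * (-A))) : Circle) • G v =
      (Ioc (1:ℝ) p).indicator (fun u => ((u * Real.log p)⁻¹ : ℝ) • ee (A * u)) v := by
    intro v
    by_cases hv : v ∈ Ioc (1:ℝ) p
    · rw [indicator_of_mem hv]
      simp only [G]
      rw [indicator_of_mem hv, Circle.smul_def, Real.fourierChar_apply]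
      simp only [ee, smul_eq_mul, Complex.real_smul]
      rw [mul_comm]
      congr 3
      push_cast; ring
    · rw [indicator_of_notMem hv]
      simp only [G]
      rw [indicator_of_notMem hv, smul_zero]
  simp_rw [e1]
  rw [integral_indicator measurableSet_Ioc, ← intervalIntegral.integral_of_le hp1.le,
    ← intervalIntegral.integral_of_le zero_le_one]
  have h3 := intervalIntegral.integral_comp_smul_deriv' (a := 0) (b := 1) (f := fun θ : ℝ => (p:ℝ) ^ θ)
    (f' := fun θ => Real.log p * (p:ℝ) ^ θ) (g := fun u => ((u * Real.log p)⁻¹ : ℝ) • ee (A * u))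
    (fun θ _ => by
      have := Real.hasStrictDerivAt_const_rpow hp0 θ
      simpa [mul_comm] using this.hasDerivAt)
    (by
      apply Continuous.continuousOn
      exact continuous_const.mul (Real.continuous_const_rpow hp0.ne'))
    (by
      rintro _ ⟨θ, _, rfl⟩
      apply ContinuousAt.continuousWithinAt
      have : (0:ℝ) < (p:ℝ) ^ θ := Real.rpow_pos_of_pos hp0 _
      have hee : ContinuousAt (fun u : ℝ => (u * Real.log p)⁻¹) ((p:ℝ)^θ) :=
        ContinuousAt.inv₀ (by fun_prop) (by positivity)
      exact ContinuousAt.smul hee (continuous_ee.comp (continuous_const.mul continuous_id)).continuousAt)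
  simp only [Real.rpow_zero, Real.rpow_one] at h3
  rw [← h3]
  refine intervalIntegral.integral_congr fun θ _ => ?_
  have : (0:ℝ) < (p:ℝ) ^ θ := Real.rpow_pos_of_pos hp0 _
  simp only [Function.comp_apply, smul_smul]
  rw [show Real.log p * (p:ℝ) ^ θ * ((p:ℝ) ^ θ * Real.log p)⁻¹ = 1 by field_simp, one_smul]

lemma sq_osc {p : ℕ} (hp : 2 ≤ p) (ρ : Measure ℝ) [IsProbabilityMeasure ρ] (hρ : ∀ x, ρ {x} = 0)
    {A : ℕ → ℝ} (hA : Tendsto (fun c => |A c|) atTop atTop) :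
    Tendsto (fun c => ∫ θ in Ioc (0:ℝ) 1, ‖∫ x, ee (A c * (p:ℝ) ^ θ * x) ∂ρ‖ ^ 2) atTop (𝓝 0) := by
  have hp0 : (0:ℝ) < p := by positivity
  have hcr : Continuous (fun θ : ℝ => (p:ℝ) ^ θ) := Real.continuous_const_rpow hp0.ne'
  have hsq : ∀ B : ℝ, ((‖∫ x, ee (B * x) ∂ρ‖ ^ 2 : ℝ) : ℂ) = ∫ z, ee (B * (z.1 - z.2)) ∂(ρ.prod ρ) := by
    intro B
    have : ∀ z : ℝ × ℝ, ee (B * (z.1 - z.2)) = ee (B * z.1) * (starRingEnd ℂ) (ee (B * z.2)) := by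
      intro z; rw [mul_sub, ee_sub]
    simp_rw [this]
    rw [integral_prod_mul (fun x => ee (B * x)) (fun y => (starRingEnd ℂ) (ee (B * y))), integral_conj,
      Complex.mul_conj, Complex.normSq_eq_norm_sq]
  have hmain : ∀ B : ℝ, ((∫ θ in Ioc (0:ℝ) 1, ‖∫ x, ee (B * (p:ℝ) ^ θ * x) ∂ρ‖ ^ 2 : ℝ) : ℂ) =
      ∫ z, (∫ θ in Ioc (0:ℝ) 1, ee (B * (z.1 - z.2) * (p:ℝ) ^ θ)) ∂(ρ.prod ρ) := by
    intro B
    rw [← integral_complex_ofReal]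
    simp_rw [hsq]
    rw [integral_integral_swap]
    · congr 1; ext z; congr 1; ext θ; congr 1; ring
    · refine Integrable.of_bound (C := 1) ?_ (Eventually.of_forall fun z => (norm_ee _).le)
      apply Continuous.aestronglyMeasurable
      unfold Function.uncurry
      exact continuous_ee.comp (by fun_prop)
  have hlim : Tendsto (fun c => ∫ z, (∫ θ in Ioc (0:ℝ) 1, ee (A c * (z.1 - z.2) * (p:ℝ) ^ θ)) ∂(ρ.prod ρ))
      atTop (𝓝 (∫ z, (0:ℂ) ∂(ρ.prod ρ))) := by
    refine tendsto_integral_of_dominated_convergence (fun _ => 1) ?_ (integrable_const _) ?_ ?_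
    · intro c
      have : Measurable (Function.uncurry fun (z : ℝ × ℝ) (θ : ℝ) => ee (A c * (z.1 - z.2) * (p:ℝ) ^ θ)) := by
        apply Continuous.measurable
        unfold Function.uncurry
        exact continuous_ee.comp (by fun_prop)
      exact (this.stronglyMeasurable.integral_prod_right).aestronglyMeasurable
    · intro c
      refine Eventually.of_forall fun z => ?_
      refine (norm_integral_le_of_norm_le_const (C := 1) (Eventually.of_forall fun ω => (norm_ee _).le)).trans (by simp)
    · have hne : ∀ᵐ z ∂(ρ.prod ρ), z.1 ≠ z.2 := by
        have hm : MeasurableSet {z : ℝ × ℝ | z.1 = z.2} := measurableSet_eq_fun measurable_fst measurable_snd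
        rw [ae_iff]
        simp only [ne_eq, not_not]
        rw [Measure.measure_prod_null hm]
        refine Eventually.of_forall fun x => ?_
        have : Prod.mk x ⁻¹' {z : ℝ × ℝ | z.1 = z.2} = {x} := by
          ext y; exact eq_comm
        change ρ (Prod.mk x ⁻¹' {z : ℝ × ℝ | z.1 = z.2}) = 0
        rw [this]; exact hρ x
      filter_upwards [hne] with z hz
      have hz' : 0 < |z.1 - z.2| := abs_pos.2 (sub_ne_zero.2 hz)
      refine (psi_tendsto hp).comp ?_
      rw [← Metric.cobounded_eq_cocompact, ← tendsto_norm_atTop_iff_cobounded]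
      simp_rw [Real.norm_eq_abs, abs_mul]
      exact hA.atTop_mul_const hz'
  rw [integral_zero] at hlim
  simp_rw [← hmain] at hlim
  have := (Complex.continuous_re.tendsto _).comp hlim
  simpa [Function.comp_def] using this

section
variable {p : ℕ} [NeZero p] (P : Measure (ℤ → Fin p)) [IsProbabilityMeasure P]

lemma kap_ae {S : Set ((ℕ → Fin p) × (ℕ → Fin p))} (hS : MeasurableSet S)
    (h : ∀ᵐ ω ∂P, (past ω, fut ω) ∈ S) : ∀ᵐ ω ∂P, ∀ᵐ y ∂(kap P (past ω)), (past ω, y) ∈ S := by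
  have h1 := kap_lintegral P (F := fun b y => Sᶜ.indicator 1 (b, y)) (measurable_one.indicator hS.compl)
  have h2 : ∫⁻ ω, Sᶜ.indicator (1 : (ℕ → Fin p) × (ℕ → Fin p) → ℝ≥0∞) (past ω, fut ω) ∂P = 0 := by
    refine (lintegral_eq_zero_iff (f := fun ω => Sᶜ.indicator (1 : (ℕ → Fin p) × (ℕ → Fin p) → ℝ≥0∞) (past ω, fut ω))
      ((measurable_one.indicator hS.compl).comp (measurable_past.prodMk measurable_fut))).2 ?_
    filter_upwards [h] with ω hω
    simp [hω]
  rw [h2, lintegral_eq_zero_iff] at h1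
  · filter_upwards [h1] with ω hω
    rw [Pi.zero_apply, lintegral_eq_zero_iff] at hω
    · filter_upwards [hω] with y hy
      by_contra hc
      have : (past ω, y) ∈ Sᶜ := hc
      simp [indicator_of_mem this] at hy
    · exact (measurable_one.indicator hS.compl).comp measurable_prodMk_left
  · exact (Measurable.lintegral_kernel_prod_right (κ := kap P)
      (f := fun b y => Sᶜ.indicator 1 (b, y)) (measurable_one.indicator hS.compl)).comp measurable_past

lemma kap_noatom {D : ℝ → (ℕ → Fin p)} (hD : Measurable D) (hfm : ∀ᵐ ω ∂P, fmass P ω = 0)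
    (hDf : ∀ᵐ ω ∂P, D (Real.ofDigits (fut ω)) = fut ω) :
    ∀ᵐ ω ∂P, ∀ x, ((kap P (past ω)).map Real.ofDigits) {x} = 0 := by
  have hmv : Measurable (Real.ofDigits (b := p)) := Real.continuous_ofDigits.measurable
  have hS1 : MeasurableSet {z : (ℕ → Fin p) × (ℕ → Fin p) | kap P z.1 {z.2} = 0} := by
    let K : Kernel ((ℕ → Fin p) × (ℕ → Fin p)) (ℕ → Fin p) := (kap P).comap Prod.fst measurable_fst
    have h1 : Measurable (fun z : (ℕ → Fin p) × (ℕ → Fin p) => K z (Prod.mk z ⁻¹' {t | t.2 = t.1.2})) := by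
      refine Kernel.measurable_kernel_prodMk_left (κ := K) ?_
      exact measurableSet_eq_fun measurable_snd (measurable_snd.comp measurable_fst)
    exact measurableSet_eq_fun h1 measurable_const
  have hS2 : MeasurableSet {z : (ℕ → Fin p) × (ℕ → Fin p) | D (Real.ofDigits z.2) = z.2} :=
    measurableSet_eq_fun (hD.comp (hmv.comp measurable_snd)) measurable_snd
  filter_upwards [kap_ae P hS1 hfm, kap_ae P hS2 hDf] with ω h1 h2 x
  rw [Measure.map_apply hmv (measurableSet_singleton x)]
  have h3 : kap P (past ω) (Real.ofDigits ⁻¹' {x}) ≤ kap P (past ω) {D x} := by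
    refine measure_mono_ae ?_
    filter_upwards [h2] with y hy (hx : Real.ofDigits y = x)
    have hy : D (Real.ofDigits y) = y := hy
    change y = D x
    rw [← hx, hy]
  refine le_antisymm (h3.trans ?_) zero_le
  by_contra hc
  have hne : kap P (past ω) {D x} ≠ 0 := fun h => hc h.le
  have h4 : kap P (past ω) {y | ¬ kap P (past ω) {y} = 0} = 0 := h1
  exact hne (measure_mono_null (by rintro _ rfl; exact hne) h4)

/-- conditional characteristic function -/
noncomputable def hh (B : ℝ) (b : ℕ → Fin p) : ℂ := ∫ y, ee (B * Real.ofDigits y) ∂(kap P b)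

lemma norm_hh_le (B : ℝ) (b : ℕ → Fin p) : ‖hh P B b‖ ≤ 1 :=
  (norm_integral_le_of_norm_le_const (C := 1) (Eventually.of_forall fun ω => (norm_ee _).le)).trans (by simp)

lemma measurable_eeval (B : ℝ) : Measurable (fun y : ℕ → Fin p => ee (B * Real.ofDigits y)) :=
  continuous_ee.measurable.comp ((Real.continuous_ofDigits.measurable).const_mul B)

lemma integrable_eeval (B : ℝ) (b : ℕ → Fin p) : Integrable (fun y : ℕ → Fin p => ee (B * Real.ofDigits y)) (kap P b) :=
  Integrable.of_bound (measurable_eeval B).aestronglyMeasurable 1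
    (Eventually.of_forall fun ω => (norm_ee _).le)

lemma hh_lip (B B' : ℝ) (b : ℕ → Fin p) : ‖hh P B b - hh P B' b‖ ≤ 2 * Real.pi * |B - B'| := by
  unfold hh
  rw [← integral_sub (integrable_eeval P B b) (integrable_eeval P B' b)]
  refine (norm_integral_le_of_norm_le_const (C := 2 * Real.pi * |B - B'|) (Eventually.of_forall fun y => ?_)).trans (by simp)
  refine (norm_ee_sub _ _).trans ?_
  rw [← sub_mul, abs_mul, abs_of_nonneg (Real.ofDigits_nonneg y)]
  exact mul_le_mul_of_nonneg_left (mul_le_of_le_one_right (abs_nonneg _) (Real.ofDigits_le_one y)) (by positivity)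

lemma continuous_hh (b : ℕ → Fin p) : Continuous (fun B => hh P B b) := by
  refine (LipschitzWith.of_dist_le_mul (K := ⟨2 * Real.pi, by positivity⟩) fun B B' => ?_).continuous
  rw [dist_eq_norm, Real.dist_eq]
  exact hh_lip P B B' b

lemma measurable_hh (B : ℝ) : Measurable (hh P B) := by
  have : StronglyMeasurable (Function.uncurry fun (b y : ℕ → Fin p) => ee (B * Real.ofDigits y)) :=
    ((measurable_eeval B).comp measurable_snd).stronglyMeasurable
  exact (this.integral_kernel_prod_right (κ := kap P)).measurable

lemma measurable_hh2 : Measurable (Function.uncurry (hh P)) :=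
  measurable_uncurry_of_continuous_of_measurable (continuous_hh P) (measurable_hh P)

lemma phi_tendsto (hp : 2 ≤ p) (hna : ∀ᵐ ω ∂P, ∀ x, ((kap P (past ω)).map Real.ofDigits) {x} = 0)
    {A : ℕ → ℝ} (hA : Tendsto (fun c => |A c|) atTop atTop) :
    Tendsto (fun c => ∫ θ in Ioc (0:ℝ) 1, ∫ ω, ‖hh P (A c * (p:ℝ) ^ θ) (past ω)‖ ∂P) atTop (𝓝 0) := by
  have hp0 : (0:ℝ) < p := by positivity
  have hcr : Continuous (fun θ : ℝ => (p:ℝ) ^ θ) := Real.continuous_const_rpow hp0.ne'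
  have hmv : Measurable (Real.ofDigits (b := p)) := Real.continuous_ofDigits.measurable
  have hm : ∀ c, Measurable (Function.uncurry fun (θ : ℝ) (ω : ℤ → Fin p) => ‖hh P (A c * (p:ℝ) ^ θ) (past ω)‖) := by
    intro c
    refine ((measurable_hh2 P).comp (Measurable.prodMk ?_ (measurable_past.comp measurable_snd))).norm
    exact ((hcr.measurable.comp measurable_fst).const_mul _)
  have hswap : ∀ c, ∫ θ in Ioc (0:ℝ) 1, ∫ ω, ‖hh P (A c * (p:ℝ) ^ θ) (past ω)‖ ∂P =
      ∫ ω, (∫ θ in Ioc (0:ℝ) 1, ‖hh P (A c * (p:ℝ) ^ θ) (past ω)‖) ∂P := by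
    intro c
    refine integral_integral_swap ?_
    refine Integrable.of_bound (hm c).aestronglyMeasurable 1 (Eventually.of_forall fun z => ?_)
    rw [Function.uncurry, norm_norm]
    exact norm_hh_le _ _ _
  simp_rw [hswap]
  suffices hsuff : Tendsto (fun c => ∫ ω, (∫ θ in Ioc (0:ℝ) 1, ‖hh P (A c * (p:ℝ) ^ θ) (past ω)‖) ∂P) atTop
      (𝓝 (∫ ω, (0:ℝ) ∂P)) by simpa using hsuff
  refine tendsto_integral_of_dominated_convergence (fun _ => 1) ?_ (integrable_const _) ?_ ?_
  · intro c
    exact (StronglyMeasurable.integral_prod_right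
      (f := fun ω θ => ‖hh P (A c * (p:ℝ) ^ θ) (past ω)‖)
      ((hm c).comp measurable_swap).stronglyMeasurable).aestronglyMeasurable
  · intro c
    refine Eventually.of_forall fun ω => ?_
    refine (norm_integral_le_of_norm_le_const (C := 1) (Eventually.of_forall fun θ => ?_)).trans (by simp)
    rw [norm_norm]; exact norm_hh_le _ _ _
  · filter_upwards [hna] with ω hω
    have : IsProbabilityMeasure ((kap P (past ω)).map Real.ofDigits) :=
      Measure.isProbabilityMeasure_map hmv.aemeasurable
    have h1 := sq_osc hp _ hω hA
    have h2 : ∀ B : ℝ, ∫ x, ee (B * x) ∂((kap P (past ω)).map Real.ofDigits) = hh P B (past ω) := by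
      intro B
      exact integral_map hmv.aemeasurable
        (continuous_ee.comp (continuous_const.mul continuous_id)).aestronglyMeasurable
    simp_rw [h2] at h1
    have hc1 : ∀ c, Continuous fun θ : ℝ => ‖hh P (A c * (p:ℝ) ^ θ) (past ω)‖ := fun c =>
      ((continuous_hh P (past ω)).comp (continuous_const.mul hcr)).norm
    rw [Metric.tendsto_atTop] at h1 ⊢
    intro ε hε
    obtain ⟨N, hN⟩ := h1 (ε ^ 2) (by positivity)
    refine ⟨N, fun c hc => ?_⟩
    have h3 := hN c hc
    rw [Real.dist_eq, sub_zero, abs_of_nonneg (integral_nonneg fun θ => by positivity)] at h3 ⊢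
    have h4 : ∫ θ in Ioc (0:ℝ) 1, ‖hh P (A c * (p:ℝ) ^ θ) (past ω)‖ ≤
        ∫ θ in Ioc (0:ℝ) 1, (ε / 2 + ‖hh P (A c * (p:ℝ) ^ θ) (past ω)‖ ^ 2 / (2 * ε)) := by
      refine integral_mono ((hc1 c).integrableOn_Ioc) ?_ fun θ => ?_
      · exact (Continuous.integrableOn_Ioc (by have := hc1 c; fun_prop))
      · simp only
        set a := ‖hh P (A c * (p:ℝ) ^ θ) (past ω)‖
        have : ε / 2 + a ^ 2 / (2 * ε) - a = (a - ε)^2 / (2 * ε) := by field_simp; ring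
        have : 0 ≤ (a - ε)^2 / (2 * ε) := by positivity
        linarith
    have i4 : IntegrableOn (fun θ : ℝ => ‖hh P (A c * (p:ℝ) ^ θ) (past ω)‖ ^ 2 / (2 * ε)) (Ioc 0 1) :=
      Continuous.integrableOn_Ioc (by have := hc1 c; fun_prop)
    have e6 : ∫ θ in Ioc (0:ℝ) 1, ‖hh P (A c * (p:ℝ) ^ θ) (past ω)‖ ^ 2 / (2 * ε) =
      (∫ θ in Ioc (0:ℝ) 1, ‖hh P (A c * (p:ℝ) ^ θ) (past ω)‖ ^ 2) / (2 * ε) := integral_div _ _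
    rw [integral_add (integrable_const _) i4, e6] at h4
    simp only [integral_const, MeasurableSet.univ, measureReal_restrict_apply, univ_inter, Real.volume_real_Ioc,
      smul_eq_mul] at h4
    have h5 : (∫ θ in Ioc (0:ℝ) 1, ‖hh P (A c * (p:ℝ) ^ θ) (past ω)‖ ^ 2) / (2 * ε) < ε / 2 := by
      rw [div_lt_iff₀ (by positivity)]; linarith
    norm_num at h4
    linarith
end
end SEq

namespace SEq
open ProbabilityTheory

/-- the first `k` digits, read off from the past of the `k`-th shift -/
noncomputable def psum {p : ℕ} (k : ℕ) (b : ℕ → Fin p) : ℝ :=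
  ∑ j ∈ Finset.range k, Real.ofDigitsTerm (fun n => b (k - 1 - n)) j

lemma measurable_psum {p : ℕ} (k : ℕ) : Measurable (psum (p := p) k) := by
  unfold psum
  refine Finset.measurable_sum _ fun j _ => ?_
  unfold Real.ofDigitsTerm
  exact ((measurable_of_countable (fun d : Fin p => (d : ℝ))).comp (measurable_pi_apply (k - 1 - j))).mul_const _

lemma val_eq {p : ℕ} (ω : ℤ → Fin p) (k : ℕ) : Real.ofDigits (fut ω) =
    psum k (past (tshift^[k] ω)) + ((p:ℝ) ^ k)⁻¹ * Real.ofDigits (fut (tshift^[k] ω)) := by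
  rw [Real.ofDigits_eq_sum_add_ofDigits (fut ω) k]
  congr 1
  · unfold psum
    refine Finset.sum_congr rfl fun j hj => ?_
    have hj := Finset.mem_range.1 hj
    unfold Real.ofDigitsTerm
    simp only [past, fut, iterate_tshift]
    congr 4
    omega
  · congr 2
    ext n
    simp only [fut, iterate_tshift]
    push_cast; rfl

section
variable {p : ℕ} [NeZero p] (P : Measure (ℤ → Fin p)) [IsProbabilityMeasure P]

lemma mean_zero {g : (ℕ → Fin p) → ℂ} (hg : Measurable g) {M : ℝ} (hM : ∀ b, ‖g b‖ ≤ M) (B : ℝ) :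
    ∫ ω, g (past ω) * (ee (B * Real.ofDigits (fut ω)) - hh P B (past ω)) ∂P = 0 := by
  have h := compProd_map_condDistrib (mβ := MeasurableSpace.pi) (X := past) (Y := fut) (μ := P) measurable_fut.aemeasurable
  have hm : Measurable (fun z : (ℕ → Fin p) × (ℕ → Fin p) => g z.1 * (ee (B * Real.ofDigits z.2) - hh P B z.1)) :=
    (hg.comp measurable_fst).mul (((measurable_eeval B).comp measurable_snd).sub ((measurable_hh P B).comp measurable_fst))
  have hmp : IsProbabilityMeasure (P.map (fun ω : ℤ → Fin p => past ω)) :=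
    Measure.isProbabilityMeasure_map measurable_past.aemeasurable
  have hi : Integrable (fun z : (ℕ → Fin p) × (ℕ → Fin p) => g z.1 * (ee (B * Real.ofDigits z.2) - hh P B z.1))
      ((P.map past) ⊗ₘ (kap P)) := by
    refine Integrable.of_bound hm.aestronglyMeasurable (M * 2) (Eventually.of_forall fun z => ?_)
    rw [norm_mul]
    refine mul_le_mul (hM _) ?_ (norm_nonneg _) ((norm_nonneg _).trans (hM z.1))
    refine (norm_sub_le _ _).trans ?_
    rw [norm_ee]; linarith [norm_hh_le P B z.1]
  have h1 := Measure.integral_compProd hi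
  unfold kap at h1
  rw [h, integral_map (measurable_past.prodMk measurable_fut).aemeasurable hm.aestronglyMeasurable] at h1
  rw [show (∫ ω, g (past ω) * (ee (B * Real.ofDigits (fut ω)) - hh P B (past ω)) ∂P) = _ from h1]
  refine integral_eq_zero_of_ae (Eventually.of_forall fun b => ?_)
  change ∫ y, g b * (ee (B * Real.ofDigits y) - hh P B b) ∂(kap P b) = 0
  rw [integral_const_mul, integral_sub (integrable_eeval P B b) (integrable_const _)]
  simp [hh]

lemma mean_zero_shift (hP : MeasurePreserving tshift P P) {g : (ℕ → Fin p) → ℂ} (hg : Measurable g) {M : ℝ}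
    (hM : ∀ b, ‖g b‖ ≤ M) (B : ℝ) (k : ℕ) :
    ∫ ω, g (past (tshift^[k] ω)) * (ee (B * Real.ofDigits (fut (tshift^[k] ω))) - hh P B (past (tshift^[k] ω))) ∂P = 0 := by
  have hk := hP.iterate k
  have hm : Measurable (fun ω : ℤ → Fin p => g (past ω) * (ee (B * Real.ofDigits (fut ω)) - hh P B (past ω))) :=
    (hg.comp measurable_past).mul (((measurable_eeval B).comp measurable_fut).sub ((measurable_hh P B).comp measurable_past))
  have := integral_map (μ := P) (φ := tshift^[k]) hk.measurable.aemeasurable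
    (f := fun ω : ℤ → Fin p => g (past ω) * (ee (B * Real.ofDigits (fut ω)) - hh P B (past ω))) hm.aestronglyMeasurable
  rw [← this, hk.map_eq, mean_zero P hg hM]

/-- the martingale differences -/
noncomputable def dd (u : (ℕ → Fin p) → ℂ) (B : ℝ) (k : ℕ) (ω : ℤ → Fin p) : ℂ :=
  u (past (tshift^[k] ω)) * (ee (B * Real.ofDigits (fut (tshift^[k] ω))) - hh P B (past (tshift^[k] ω)))

lemma measurable_dd {u : (ℕ → Fin p) → ℂ} (hu : Measurable u) (B : ℝ) (k : ℕ) : Measurable (dd P u B k) := by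
  have hm : Measurable (fun ω : ℤ → Fin p => u (past ω) * (ee (B * Real.ofDigits (fut ω)) - hh P B (past ω))) :=
    (hu.comp measurable_past).mul (((measurable_eeval B).comp measurable_fut).sub ((measurable_hh P B).comp measurable_past))
  exact hm.comp (measurable_tshift.iterate k)

lemma norm_dd {u : (ℕ → Fin p) → ℂ} (hu : ∀ b, ‖u b‖ ≤ 1) (B : ℝ) (k : ℕ) (ω : ℤ → Fin p) : ‖dd P u B k ω‖ ≤ 2 := by
  unfold dd
  rw [norm_mul]
  have h2 : ‖ee (B * Real.ofDigits (fut (tshift^[k] ω))) - hh P B (past (tshift^[k] ω))‖ ≤ 2 := by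
    refine (norm_sub_le _ _).trans ?_
    rw [norm_ee]; linarith [norm_hh_le P B (past (tshift^[k] ω))]
  calc _ ≤ 1 * (2:ℝ) := mul_le_mul (hu _) h2 (norm_nonneg _) zero_le_one
    _ = 2 := by norm_num

lemma corr (hP : MeasurePreserving tshift P P) {u u' : (ℕ → Fin p) → ℂ} (hu : Measurable u) (hu' : Measurable u')
    (hb : ∀ b, ‖u b‖ ≤ 1) (hb' : ∀ b, ‖u' b‖ ≤ 1) (B B' : ℝ) (k r : ℕ) :
    |∫ ω, inner ℝ (dd P u B k ω) (dd P u' B' (k + r) ω) ∂P| ≤ 4 * Real.pi * |B| * ((p:ℝ) ^ r)⁻¹ := by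
  -- truncated version of the first factor
  let g : (ℕ → Fin p) → ℂ := fun b => u (fun n => b (n + r)) * (ee (B * psum r b) - hh P B (fun n => b (n + r)))
  have hdrop : Measurable (fun (b : ℕ → Fin p) (n : ℕ) => b (n + r)) :=
    measurable_pi_lambda _ fun n => measurable_pi_apply _
  have hgm : Measurable g := (hu.comp hdrop).mul
    ((continuous_ee.measurable.comp ((measurable_psum r).const_mul B)).sub ((measurable_hh P B).comp hdrop))
  have hgb : ∀ b, ‖g b‖ ≤ 2 := by
    intro b
    change ‖u (fun n => b (n + r)) * (ee (B * psum r b) - hh P B (fun n => b (n + r)))‖ ≤ 2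
    rw [norm_mul]
    have h2 : ‖ee (B * psum r b) - hh P B (fun n => b (n + r))‖ ≤ 2 := by
      refine (norm_sub_le _ _).trans ?_
      rw [norm_ee]; linarith [norm_hh_le P B (fun n => b (n + r))]
    calc _ ≤ 1 * (2:ℝ) := mul_le_mul (hb _) h2 (norm_nonneg _) zero_le_one
      _ = 2 := by norm_num
  have hpast : ∀ ω : ℤ → Fin p, past (tshift^[k] ω) = fun n => past (tshift^[k + r] ω) (n + r) := by
    intro ω; ext n
    simp only [past, iterate_tshift]
    congr 2; push_cast; ring
  have hclose : ∀ ω, ‖dd P u B k ω - g (past (tshift^[k + r] ω))‖ ≤ 2 * Real.pi * |B| * ((p:ℝ) ^ r)⁻¹ := by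
    intro ω
    have e : dd P u B k ω - g (past (tshift^[k + r] ω)) = u (past (tshift^[k] ω)) *
        (ee (B * Real.ofDigits (fut (tshift^[k] ω))) - ee (B * psum r (past (tshift^[k + r] ω)))) := by
      simp only [dd, g]
      rw [← hpast]; ring
    rw [e, norm_mul]
    have h1 : ‖ee (B * Real.ofDigits (fut (tshift^[k] ω))) - ee (B * psum r (past (tshift^[k + r] ω)))‖
        ≤ 2 * Real.pi * |B| * ((p:ℝ) ^ r)⁻¹ := by
      refine (norm_ee_sub _ _).trans ?_
      rw [val_eq (tshift^[k] ω) r, ← Function.iterate_add_apply, add_comm r k, ← mul_sub, add_sub_cancel_left, abs_mul,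
        abs_of_nonneg (mul_nonneg (by positivity) (Real.ofDigits_nonneg _)), mul_assoc (2 * Real.pi)]
      gcongr
      exact mul_le_of_le_one_right (by positivity) (Real.ofDigits_le_one _)
    calc _ ≤ 1 * (2 * Real.pi * |B| * ((p:ℝ) ^ r)⁻¹) := mul_le_mul (hb _) h1 (norm_nonneg _) zero_le_one
      _ = _ := one_mul _
  have hz : ∫ ω, inner ℝ (g (past (tshift^[k + r] ω))) (dd P u' B' (k + r) ω) ∂P = 0 := by
    have h0 := mean_zero_shift P hP (g := fun b => (starRingEnd ℂ) (g b) * u' b)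
      ((Complex.continuous_conj.measurable.comp hgm).mul hu') (M := 2 * 1) (fun b => by
        rw [norm_mul, RCLike.norm_conj]
        exact mul_le_mul (hgb b) (hb' b) (norm_nonneg _) (by norm_num)) B' (k + r)
    have h1 : ∀ ω, inner ℝ (g (past (tshift^[k + r] ω))) (dd P u' B' (k + r) ω) =
        Complex.re ((starRingEnd ℂ) (g (past (tshift^[k + r] ω))) * u' (past (tshift^[k + r] ω)) *
          (ee (B' * Real.ofDigits (fut (tshift^[k + r] ω))) - hh P B' (past (tshift^[k + r] ω)))) := by
      intro ω
      rw [Complex.inner, mul_assoc, mul_comm]; rfl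
    simp_rw [h1]
    have hi : Integrable (fun ω => (starRingEnd ℂ) (g (past (tshift^[k + r] ω))) * u' (past (tshift^[k + r] ω)) *
          (ee (B' * Real.ofDigits (fut (tshift^[k + r] ω))) - hh P B' (past (tshift^[k + r] ω)))) P := by
      refine Integrable.of_bound (measurable_dd P (u := fun b => (starRingEnd ℂ) (g b) * u' b)
        ((Complex.continuous_conj.measurable.comp hgm).mul hu') B' (k+r)).aestronglyMeasurable (2 * 2)
        (Eventually.of_forall fun ω => ?_)
      rw [mul_assoc, norm_mul, RCLike.norm_conj]
      exact mul_le_mul (hgb _) (norm_dd P hb' B' (k+r) ω) (norm_nonneg _) (by norm_num)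
    have h2 := integral_re hi
    simp only [RCLike.re_eq_complex_re] at h2
    rw [h2, h0, Complex.zero_re]
  have hmd := measurable_dd P hu B k
  have hmd' := measurable_dd P hu' B' (k + r)
  have hmg : Measurable (fun ω => g (past (tshift^[k + r] ω))) :=
    hgm.comp (measurable_past.comp (measurable_tshift.iterate _))
  have hi1 : Integrable (fun ω => (inner ℝ (dd P u B k ω) (dd P u' B' (k + r) ω) : ℝ)) P := by
    refine Integrable.of_bound (hmd.inner hmd').aestronglyMeasurable (2 * 2)
        (Eventually.of_forall fun ω => ?_)
    exact (norm_inner_le_norm _ _).trans (mul_le_mul (norm_dd P hb B k ω) (norm_dd P hb' B' (k+r) ω) (norm_nonneg _) (by norm_num))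
  have hi2 : Integrable (fun ω => (inner ℝ (g (past (tshift^[k + r] ω))) (dd P u' B' (k + r) ω) : ℝ)) P := by
    refine Integrable.of_bound (hmg.inner hmd').aestronglyMeasurable (2 * 2)
        (Eventually.of_forall fun ω => ?_)
    exact (norm_inner_le_norm _ _).trans (mul_le_mul (hgb _) (norm_dd P hb' B' (k+r) ω) (norm_nonneg _) (by norm_num))
  have e := integral_sub hi1 hi2
  rw [hz, sub_zero] at e
  rw [← e, ← Real.norm_eq_abs]
  refine (norm_integral_le_of_norm_le_const (C := 4 * Real.pi * |B| * ((p:ℝ) ^ r)⁻¹) (Eventually.of_forall fun ω => ?_)).trans (by simp)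
  rw [← inner_sub_left]
  refine (norm_inner_le_norm _ _).trans ?_
  calc _ ≤ (2 * Real.pi * |B| * ((p:ℝ) ^ r)⁻¹) * 2 :=
        mul_le_mul (hclose ω) (norm_dd P hb' B' (k+r) ω) (norm_nonneg _) (by positivity)
    _ = _ := by ring

lemma dd_lln (hp : 2 ≤ p) (hP : MeasurePreserving tshift P P) {u : ℕ → (ℕ → Fin p) → ℂ} (hu : ∀ i, Measurable (u i))
    (hb : ∀ i b, ‖u i b‖ ≤ 1) {B : ℕ → ℝ} {M : ℝ} (hB : ∀ i, |B i| ≤ M) {k : ℕ → ℕ} (hk : StrictMono k) :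
    ∀ᵐ ω ∂P, ∀ ε > 0, ∀ᶠ N : ℕ in atTop, ‖∑ i ∈ Finset.range N, dd P (u i) (B i) (k i) ω‖ ≤ ε * N := by
  have hM0 : 0 ≤ M := (abs_nonneg _).trans (hB 0)
  refine lln (M := 2) (K := 4 * Real.pi * M) (by positivity) (fun i => measurable_dd P (hu i) _ _)
    (fun i ω => norm_dd P (hb i) _ _ ω) fun i j hij => ?_
  have hkij : j - i ≤ k j - k i := by
    have h : ∀ n, k i + n ≤ k (i + n) := by
      intro n
      induction n with
      | zero => simp
      | succ n ih => have := hk (show i + n < i + (n + 1) by omega); omega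
    have := h (j - i)
    rw [show i + (j - i) = j by omega] at this
    omega
  have := hk hij
  obtain ⟨r, hr⟩ : ∃ r, k j = k i + r := ⟨k j - k i, by omega⟩
  rw [hr]
  refine (corr P hP (hu i) (hu j) (hb i) (hb j) _ _ _ _).trans ?_
  have hp' : (2:ℝ) ≤ p := by exact_mod_cast hp
  have h2 : ((p:ℝ) ^ r)⁻¹ ≤ (1/2)^(j-i) := by
    rw [one_div, inv_pow]
    refine inv_anti₀ (by positivity) ?_
    calc (2:ℝ)^(j-i) ≤ 2 ^ r := pow_le_pow_right₀ (by norm_num) (by omega)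
      _ ≤ p ^ r := by gcongr
  have := hB i
  gcongr
end
end SEq

namespace SEq
open ProbabilityTheory

lemma rpow_lip {p : ℕ} (hp : 2 ≤ p) : ∀ θ ∈ Icc (0:ℝ) 1, ∀ θ' ∈ Icc (0:ℝ) 1,
    |(p:ℝ) ^ θ - (p:ℝ) ^ θ'| ≤ (p * Real.log p) * |θ - θ'| := by
  intro θ hθ θ' hθ'
  have hp1 : (1:ℝ) ≤ p := by exact_mod_cast (by omega : 1 ≤ p)
  have hp0 : (0:ℝ) < p := by linarith
  have := (convex_Icc (0:ℝ) 1).norm_image_sub_le_of_norm_hasDerivWithin_le (f := fun x : ℝ => (p:ℝ) ^ x)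
    (f' := fun x => Real.log p * 1 * (p:ℝ) ^ x) (C := p * Real.log p)
    (fun x hx => ((hasDerivAt_id x).const_rpow hp0).hasDerivWithinAt) (fun x hx => ?_) hθ' hθ
  · simpa using this
  · have h1 : 0 ≤ Real.log p := Real.log_nonneg hp1
    have h2 : (p:ℝ) ^ x ≤ p := by
      calc (p:ℝ) ^ x ≤ (p:ℝ) ^ (1:ℝ) := Real.rpow_le_rpow_of_exponent_le hp1 hx.2
        _ = p := Real.rpow_one _
    have h3 : 0 ≤ (p:ℝ) ^ x := by positivity
    rw [mul_one, Real.norm_of_nonneg (by positivity), mul_comm]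
    gcongr

lemma mpow_eq {p m : ℕ} (hp : 2 ≤ p) (hpm : p < m) (i : ℕ) :
    (m:ℝ) ^ i = (p:ℝ) ^ ⌊(i:ℝ) * (Real.log m / Real.log p)⌋₊ * (p:ℝ) ^ Int.fract ((i:ℝ) * (Real.log m / Real.log p)) := by
  have hp1 : (1:ℝ) < p := by exact_mod_cast (by omega : 1 < p)
  have hp0 : (0:ℝ) < p := by linarith
  have hm1 : (1:ℝ) < m := by exact_mod_cast (by omega : 1 < m)
  have hm0 : (0:ℝ) < m := by linarith
  have hl : 0 < Real.log p := Real.log_pos hp1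
  have hα : 0 ≤ (i:ℝ) * (Real.log m / Real.log p) := by have := Real.log_pos hm1; positivity
  rw [← Real.rpow_natCast (p:ℝ), ← Real.rpow_add hp0, natCast_floor_eq_intCast_floor hα, Int.floor_add_fract,
    Real.rpow_def_of_pos hp0, ← Real.rpow_natCast (m:ℝ), Real.rpow_def_of_pos hm0]
  congr 1
  field_simp

lemma floor_strictMono {α : ℝ} (hα : 1 ≤ α) : StrictMono (fun i : ℕ => ⌊(i:ℝ) * α⌋₊) := by
  refine strictMono_nat_of_lt_succ fun i => ?_
  have : ⌊(i:ℝ) * α⌋₊ + 1 ≤ ⌊((i+1:ℕ):ℝ) * α⌋₊ := by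
    rw [← Nat.floor_add_one (by positivity)]
    refine Nat.floor_mono ?_
    push_cast; linarith
  omega

section
variable {p : ℕ} [NeZero p] (P : Measure (ℤ → Fin p)) [IsProbabilityMeasure P]

/-- the exponential terms -/
noncomputable def zz {p : ℕ} (m : ℕ) (q l : ℤ) (i : ℕ) (ω : ℤ → Fin p) : ℂ :=
  ee ((q * (m:ℝ) ^ i + l * (p:ℝ) ^ i) * Real.ofDigits (fut ω))

lemma zz_close {m : ℕ} (hp : 2 ≤ p) (hpm : p < m) (q l : ℤ) (c i : ℕ) (ω : ℤ → Fin p) :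
    ‖zz m q l (i + c) ω - ee ((q * (m:ℝ) ^ (i + c) + l * (p:ℝ) ^ (i + c)) *
        psum ⌊(i:ℝ) * (Real.log m / Real.log p)⌋₊ (past (tshift^[⌊(i:ℝ) * (Real.log m / Real.log p)⌋₊] ω))) *
      ee ((q * (m:ℝ) ^ c * (p:ℝ) ^ Int.fract ((i:ℝ) * (Real.log m / Real.log p))) *
        Real.ofDigits (fut (tshift^[⌊(i:ℝ) * (Real.log m / Real.log p)⌋₊] ω)))‖ ≤
      2 * Real.pi * |(l:ℝ)| * (p:ℝ) ^ (c + 1) * ((p:ℝ) / m) ^ i := by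
  have hp1 : (1:ℝ) ≤ p := by exact_mod_cast (by omega : 1 ≤ p)
  have hp0 : (0:ℝ) < p := by linarith
  have hm0 : (0:ℝ) < m := by exact_mod_cast (by omega : 0 < m)
  have hm := mpow_eq hp hpm i
  have hθ : (p:ℝ) ^ Int.fract ((i:ℝ) * (Real.log m / Real.log p)) ≤ p := by
      calc _ ≤ (p:ℝ) ^ (1:ℝ) := Real.rpow_le_rpow_of_exponent_le hp1 (Int.fract_lt_one _).le
        _ = p := Real.rpow_one _
  unfold zz
  rw [val_eq ω ⌊(i:ℝ) * (Real.log m / Real.log p)⌋₊]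
  set k := ⌊(i:ℝ) * (Real.log m / Real.log p)⌋₊
  set v := Real.ofDigits (fut (tshift^[k] ω))
  set T := (p:ℝ) ^ Int.fract ((i:ℝ) * (Real.log m / Real.log p))
  set S := psum k (past (tshift^[k] ω))
  rw [← ee_add]
  refine (norm_ee_sub _ _).trans ?_
  have hv0 : 0 ≤ v := Real.ofDigits_nonneg _
  have hv1 : v ≤ 1 := Real.ofDigits_le_one _
  have e : (q * (m:ℝ) ^ (i + c) + l * (p:ℝ) ^ (i + c)) * (S + ((p:ℝ) ^ k)⁻¹ * v) -
      ((q * (m:ℝ) ^ (i + c) + l * (p:ℝ) ^ (i + c)) * S + q * (m:ℝ) ^ c * T * v) =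
      l * ((p:ℝ) ^ (i + c) * ((p:ℝ) ^ k)⁻¹ * v) := by
    rw [pow_add (m:ℝ), hm]
    field_simp
    ring
  rw [e, abs_mul, abs_of_nonneg (by positivity : (0:ℝ) ≤ (p:ℝ) ^ (i + c) * ((p:ℝ) ^ k)⁻¹ * v)]
  have h1 : (p:ℝ) ^ (i + c) * ((p:ℝ) ^ k)⁻¹ * v ≤ (p:ℝ) ^ (c + 1) * ((p:ℝ) / m) ^ i := by
    have h2 : ((p:ℝ) ^ k)⁻¹ ≤ p / (m:ℝ) ^ i := by
      rw [inv_eq_one_div, div_le_div_iff₀ (by positivity) (by positivity), one_mul, hm, mul_comm]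
      gcongr
    calc (p:ℝ) ^ (i + c) * ((p:ℝ) ^ k)⁻¹ * v ≤ (p:ℝ) ^ (i + c) * (p / (m:ℝ) ^ i) * 1 := by gcongr
      _ = _ := by rw [div_pow]; ring
  calc _ ≤ 2 * Real.pi * (|(l:ℝ)| * ((p:ℝ) ^ (c + 1) * ((p:ℝ) / m) ^ i)) := by gcongr
    _ = _ := by ring

lemma bad_subset {m : ℕ} (hp : 2 ≤ p) (hpm : p < m) (hP : MeasurePreserving tshift P P) (q l : ℤ) (c : ℕ) {t : ℝ}
    (ht : 0 < t) :
    ∀ᵐ ω ∂P, (∃ᶠ N : ℕ in atTop, 2 * t * N < ‖∑ i ∈ Finset.range N, zz m q l i ω‖) →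
      ω ∈ evt tshift (Real.log m / Real.log p) (fun θ ω => ‖hh P ((q * (m:ℝ) ^ c) * (p:ℝ) ^ θ) (past ω)‖) t := by
  have hp1 : (1:ℝ) < p := by exact_mod_cast (by omega : 1 < p)
  have hp0 : (0:ℝ) < p := by linarith
  have hm0 : (0:ℝ) < m := by exact_mod_cast (by omega : 0 < m)
  have hpm' : (p:ℝ) < m := by exact_mod_cast hpm
  have hl : 0 < Real.log p := Real.log_pos hp1
  have hα : 1 ≤ Real.log m / Real.log p := by
    rw [le_div_iff₀ hl, one_mul]; exact Real.log_le_log hp0 hpm'.le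
  set α := Real.log m / Real.log p with hαdef
  have hlln := dd_lln P hp hP
    (u := fun i b => ee ((q * (m:ℝ) ^ (i + c) + l * (p:ℝ) ^ (i + c)) * psum ⌊(i:ℝ) * α⌋₊ b))
    (fun i => continuous_ee.measurable.comp ((measurable_psum _).const_mul _))
    (fun i b => (norm_ee _).le)
    (B := fun i => q * (m:ℝ) ^ c * (p:ℝ) ^ Int.fract ((i:ℝ) * α))
    (M := |(q:ℝ) * (m:ℝ) ^ c| * p) (fun i => by
      have hθ : (p:ℝ) ^ Int.fract ((i:ℝ) * α) ≤ p := by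
        calc _ ≤ (p:ℝ) ^ (1:ℝ) := Real.rpow_le_rpow_of_exponent_le hp1.le (Int.fract_lt_one _).le
          _ = p := Real.rpow_one _
      rw [abs_mul, abs_of_nonneg (by positivity : 0 ≤ (p:ℝ) ^ Int.fract ((i:ℝ) * α))]
      gcongr)
    (floor_strictMono hα)
  filter_upwards [hlln] with ω hω hfreq
  -- the geometric error
  set C0 := 2 * Real.pi * |(l:ℝ)| * (p:ℝ) ^ (c + 1) with hC0
  have hC00 : 0 ≤ C0 := by positivity
  have hr0 : 0 ≤ (p:ℝ) / m := by positivity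
  have hr1 : (p:ℝ) / m < 1 := by rw [div_lt_one hm0]; exact hpm'
  set C1 := 2 * c + C0 * (1 - (p:ℝ) / m)⁻¹ with hC1
  have hC : ∀ᶠ N : ℕ in atTop, C1 ≤ t / 2 * N := by
    have := (tendsto_natCast_atTop_atTop (R := ℝ)).const_mul_atTop (half_pos ht)
    exact this.eventually_ge_atTop C1
  refine (hfreq.and_eventually ((hω (t/2) (half_pos ht)).and hC)).mono ?_
  rintro N ⟨h1, h2, h3⟩
  have hgeo : ∑ i ∈ Finset.range N, ((p:ℝ) / m) ^ i ≤ (1 - (p:ℝ) / m)⁻¹ := by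
    rw [← tsum_geometric_of_lt_one hr0 hr1]
    exact (summable_geometric_of_lt_one hr0 hr1).sum_le_tsum _ fun i _ => by positivity
  have hzn : ∀ i, ‖zz m q l i ω‖ ≤ 1 := fun i => (norm_ee _).le
  -- shift by c
  have hsh : ‖∑ i ∈ Finset.range N, zz m q l i ω‖ ≤ 2 * c + ‖∑ i ∈ Finset.range N, zz m q l (i + c) ω‖ := by
    have e1 := Finset.sum_range_add (fun i => zz m q l i ω) N c
    have e2 := Finset.sum_range_add (fun i => zz m q l i ω) c N
    rw [add_comm c N] at e2
    have e3 : ∑ i ∈ Finset.range N, zz m q l i ω = ∑ i ∈ Finset.range c, zz m q l i ω +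
        ∑ i ∈ Finset.range N, zz m q l (i + c) ω - ∑ i ∈ Finset.range c, zz m q l (N + i) ω := by
      rw [eq_sub_iff_add_eq, ← e1, e2]
      simp_rw [add_comm c]
    have n1 : ‖∑ i ∈ Finset.range c, zz m q l i ω‖ ≤ c := by
      simpa using norm_sum_le_of_le (Finset.range c) (fun i _ => hzn i)
    have n2 : ‖∑ i ∈ Finset.range c, zz m q l (N + i) ω‖ ≤ c := by
      simpa using norm_sum_le_of_le (Finset.range c) (fun i _ => hzn (N + i))
    rw [e3]
    refine (norm_sub_le _ _).trans ?_
    have := norm_add_le (∑ i ∈ Finset.range c, zz m q l i ω) (∑ i ∈ Finset.range N, zz m q l (i + c) ω)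
    linarith
  -- decompose
  set d : ℕ → ℂ := fun i => dd P (fun b => ee ((q * (m:ℝ) ^ (i + c) + l * (p:ℝ) ^ (i + c)) * psum ⌊(i:ℝ) * α⌋₊ b))
      (q * (m:ℝ) ^ c * (p:ℝ) ^ Int.fract ((i:ℝ) * α)) ⌊(i:ℝ) * α⌋₊ ω with hd
  have hterm : ∀ i, ‖zz m q l (i + c) ω - d i‖ ≤ C0 * ((p:ℝ) / m) ^ i +
      ‖hh P ((q * (m:ℝ) ^ c) * (p:ℝ) ^ Int.fract ((i:ℝ) * α)) (past (tshift^[⌊(i:ℝ) * α⌋₊] ω))‖ := by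
    intro i
    have hz := zz_close hp hpm q l c i ω
    rw [← hαdef] at hz
    set E1 := ee ((q * (m:ℝ) ^ (i + c) + l * (p:ℝ) ^ (i + c)) * psum ⌊(i:ℝ) * α⌋₊ (past (tshift^[⌊(i:ℝ) * α⌋₊] ω))) with hE1
    set E2 := ee ((q * (m:ℝ) ^ c * (p:ℝ) ^ Int.fract ((i:ℝ) * α)) * Real.ofDigits (fut (tshift^[⌊(i:ℝ) * α⌋₊] ω)))
    set H := hh P ((q * (m:ℝ) ^ c) * (p:ℝ) ^ Int.fract ((i:ℝ) * α)) (past (tshift^[⌊(i:ℝ) * α⌋₊] ω))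
    have e : zz m q l (i + c) ω - d i = (zz m q l (i + c) ω - E1 * E2) + E1 * H := by
      have : d i = E1 * (E2 - H) := rfl
      rw [this]; ring
    rw [e]
    refine (norm_add_le _ _).trans (add_le_add hz ?_)
    rw [norm_mul, hE1, norm_ee, one_mul]
  have hsum : ‖∑ i ∈ Finset.range N, zz m q l (i + c) ω‖ ≤ ‖∑ i ∈ Finset.range N, d i‖ + C0 * (1 - (p:ℝ) / m)⁻¹ +
      ∑ i ∈ Finset.range N, ‖hh P ((q * (m:ℝ) ^ c) * (p:ℝ) ^ Int.fract ((i:ℝ) * α)) (past (tshift^[⌊(i:ℝ) * α⌋₊] ω))‖ := by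
    have e : ∑ i ∈ Finset.range N, zz m q l (i + c) ω = ∑ i ∈ Finset.range N, d i +
        ∑ i ∈ Finset.range N, (zz m q l (i + c) ω - d i) := by
      rw [Finset.sum_sub_distrib]; ring
    rw [e]
    refine (norm_add_le _ _).trans ?_
    have h5 := norm_sum_le_of_le (Finset.range N) (fun i _ => hterm i)
    rw [Finset.sum_add_distrib, ← Finset.mul_sum] at h5
    have h6 := mul_le_mul_of_nonneg_left hgeo hC00
    linarith
  have h2' : ‖∑ i ∈ Finset.range N, d i‖ ≤ t / 2 * N := h2
  linarith

lemma z_null {m : ℕ} (hp : 2 ≤ p) (hpm : p < m) (hirr : Irrational (Real.log m / Real.log p))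
    (hP : MeasurePreserving tshift P P)
    (hna : ∀ᵐ ω ∂P, ∀ x, ((kap P (past ω)).map Real.ofDigits) {x} = 0) {q : ℤ} (hq : q ≠ 0) (l : ℤ) {t : ℝ}
    (ht : 0 < t) :
    P {ω | ∃ᶠ N : ℕ in atTop, 2 * t * N < ‖∑ i ∈ Finset.range N, zz m q l i ω‖} = 0 := by
  have hp1 : (1:ℝ) < p := by exact_mod_cast (by omega : 1 < p)
  have hp0 : (0:ℝ) < p := by linarith
  have hm1 : (1:ℝ) < m := by exact_mod_cast (by omega : 1 < m)
  have hl : 0 < Real.log p := Real.log_pos hp1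
  have hα : 0 < Real.log m / Real.log p := div_pos (Real.log_pos hm1) hl
  have hcr : Continuous (fun θ : ℝ => (p:ℝ) ^ θ) := Real.continuous_const_rpow hp0.ne'
  set bad := {ω : ℤ → Fin p | ∃ᶠ N : ℕ in atTop, 2 * t * N < ‖∑ i ∈ Finset.range N, zz m q l i ω‖} with hbad
  have hA : Tendsto (fun c : ℕ => |(q:ℝ) * (m:ℝ) ^ c|) atTop atTop := by
    have : ∀ c : ℕ, |(q:ℝ) * (m:ℝ) ^ c| = |(q:ℝ)| * (m:ℝ) ^ c := fun c => by
      rw [abs_mul, abs_of_nonneg (by positivity : (0:ℝ) ≤ (m:ℝ) ^ c)]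
    simp_rw [this]
    exact (tendsto_pow_atTop_atTop_of_one_lt hm1).const_mul_atTop (abs_pos.2 (by exact_mod_cast hq))
  have hphi := phi_tendsto P hp hna hA
  have hle : ∀ c : ℕ, P.real bad * (t / 2) ≤
      ∫ θ in Ioc (0:ℝ) 1, ∫ ω, ‖hh P ((q * (m:ℝ) ^ c) * (p:ℝ) ^ θ) (past ω)‖ ∂P := by
    intro c
    have h1 := skew_bound (σ := tshift) (P := P) (α := Real.log m / Real.log p)
      (F := fun θ ω => ‖hh P ((q * (m:ℝ) ^ c) * (p:ℝ) ^ θ) (past ω)‖)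
      (L := 2 * Real.pi * (|(q * (m:ℝ) ^ c)| * (p * Real.log p))) (t := t) hP hirr hα
      (fun θ ω => norm_nonneg _) (fun θ ω => norm_hh_le _ _ _)
      (fun θ => ((measurable_hh P _).comp measurable_past).norm)
      (fun ω => ((continuous_hh P (past ω)).comp (continuous_const.mul hcr)).norm)
      (by positivity)
      (fun ω θ hθ θ' hθ' => by
        refine (abs_norm_sub_norm_le _ _).trans ((hh_lip P _ _ _).trans ?_)
        rw [← mul_sub, abs_mul]
        have := rpow_lip hp θ hθ θ' hθ'
        calc _ ≤ 2 * Real.pi * (|(q * (m:ℝ) ^ c)| * ((p * Real.log p) * |θ - θ'|)) := by gcongr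
          _ = _ := by ring)
      ht
    refine le_trans ?_ h1
    have h2 : P bad ≤ P (evt tshift (Real.log m / Real.log p) (fun θ ω => ‖hh P ((q * (m:ℝ) ^ c) * (p:ℝ) ^ θ) (past ω)‖) t) :=
      measure_mono_ae (by
        filter_upwards [bad_subset P hp hpm hP q l c ht] with ω hω h
        exact hω h)
    have h3 : P.real bad ≤ P.real (evt tshift (Real.log m / Real.log p) (fun θ ω => ‖hh P ((q * (m:ℝ) ^ c) * (p:ℝ) ^ θ) (past ω)‖) t) :=
      ENNReal.toReal_mono (measure_ne_top _ _) h2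
    gcongr
  have h4 : P.real bad * (t / 2) ≤ 0 := ge_of_tendsto' hphi hle
  have h5 : P.real bad ≤ 0 := by
    by_contra h
    have := mul_pos (not_le.1 h) (half_pos ht)
    linarith
  have h6 : P.real bad = 0 := le_antisymm h5 measureReal_nonneg
  rwa [measureReal_eq_zero_iff] at h6

lemma z_tendsto {m : ℕ} (hp : 2 ≤ p) (hpm : p < m) (hirr : Irrational (Real.log m / Real.log p))
    (hP : MeasurePreserving tshift P P)
    (hna : ∀ᵐ ω ∂P, ∀ x, ((kap P (past ω)).map Real.ofDigits) {x} = 0) {q : ℤ} (hq : q ≠ 0) (l : ℤ) :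
    ∀ᵐ ω ∂P, Tendsto (fun N : ℕ => (1 / N : ℂ) * ∑ i ∈ Finset.range N, zz m q l i ω) atTop (𝓝 0) := by
  have h : ∀ᵐ ω ∂P, ∀ n : ℕ, ¬ ∃ᶠ N : ℕ in atTop, 2 * (1 / (n + 1 : ℝ)) * N < ‖∑ i ∈ Finset.range N, zz m q l i ω‖ := by
    rw [ae_all_iff]
    intro n
    have := z_null P hp hpm hirr hP hna hq l (t := 1 / (n + 1 : ℝ)) (by positivity)
    rw [ae_iff]
    simp only [not_not]
    exact this
  filter_upwards [h] with ω hω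
  rw [Metric.tendsto_atTop]
  intro ε hε
  obtain ⟨n, hn⟩ := exists_nat_one_div_lt (show 0 < ε / 2 by positivity)
  have h1 := hω n
  rw [not_frequently] at h1
  obtain ⟨N0, hN0⟩ := eventually_atTop.1 h1
  refine ⟨max N0 1, fun N hN => ?_⟩
  have h2 := not_lt.1 (hN0 N (le_trans (le_max_left _ _) hN))
  have hN1 : (0:ℝ) < N := by exact_mod_cast lt_of_lt_of_le zero_lt_one (le_trans (le_max_right _ _) hN)
  rw [dist_zero_right, norm_mul, norm_div, norm_one, Complex.norm_natCast, one_div, ← div_eq_inv_mul, div_lt_iff₀ hN1]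
  have h3 : 2 * (1 / (n + 1 : ℝ)) * N < ε * N := by
    apply mul_lt_mul_of_pos_right _ hN1; linarith
  linarith
end
end SEq

namespace SEq

lemma weyl {X : Type*} [TopologicalSpace X] [CompactSpace X] [MeasurableSpace X] [OpensMeasurableSpace X]
    (ρ : Measure X) [IsProbabilityMeasure ρ] (s : ℕ → X) (A : Set C(X, ℂ))
    (hA : (Submodule.span ℂ A).topologicalClosure = ⊤)
    (h : ∀ g ∈ A, Tendsto (fun N : ℕ => (1 / N : ℂ) * ∑ i ∈ Finset.range N, g (s i)) atTop (𝓝 (∫ x, g x ∂ρ)))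
    (g : C(X, ℂ)) :
    Tendsto (fun N : ℕ => (1 / N : ℂ) * ∑ i ∈ Finset.range N, g (s i)) atTop (𝓝 (∫ x, g x ∂ρ)) := by
  have hIntg : ∀ g : C(X, ℂ), Integrable (fun x => g x) ρ := fun g =>
    Integrable.of_bound g.continuous.measurable.aestronglyMeasurable ‖g‖ (Eventually.of_forall g.norm_coe_le_norm)
  have hspan : ∀ g ∈ Submodule.span ℂ A,
      Tendsto (fun N : ℕ => (1 / N : ℂ) * ∑ i ∈ Finset.range N, g (s i)) atTop (𝓝 (∫ x, g x ∂ρ)) := by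
    intro g hg
    induction hg using Submodule.span_induction with
    | mem x hx => exact h x hx
    | zero => simp
    | add x y _ _ hx hy =>
      simp only [ContinuousMap.add_apply, Finset.sum_add_distrib, mul_add]
      rw [integral_add (hIntg x) (hIntg y)]
      exact hx.add hy
    | smul a x _ hx =>
      simp only [ContinuousMap.smul_apply, smul_eq_mul, ← Finset.mul_sum]
      rw [integral_const_mul]
      refine (hx.const_mul a).congr fun N => ?_
      ring
  have hg : g ∈ closure (Submodule.span ℂ A : Set C(X, ℂ)) := by
    rw [← Submodule.topologicalClosure_coe, hA]; trivial
  rw [Metric.tendsto_atTop]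
  intro ε hε
  obtain ⟨g', hg', hd⟩ := Metric.mem_closure_iff.1 hg (ε / 3) (by positivity)
  obtain ⟨N0, hN0⟩ := Metric.tendsto_atTop.1 (hspan g' hg') (ε / 3) (by positivity)
  refine ⟨N0, fun N hN => ?_⟩
  have h1 := hN0 N hN
  have hpt : ∀ x, ‖g x - g' x‖ ≤ ε / 3 := fun x => by
    rw [← dist_eq_norm]; exact (ContinuousMap.dist_apply_le_dist x).trans hd.le
  have h2 : dist (∫ x, g' x ∂ρ) (∫ x, g x ∂ρ) ≤ ε / 3 := by
    rw [dist_comm, dist_eq_norm, ← integral_sub (hIntg g) (hIntg g')]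
    exact (norm_integral_le_of_norm_le_const (Eventually.of_forall hpt)).trans (by simp)
  have h3 : dist ((1 / N : ℂ) * ∑ i ∈ Finset.range N, g (s i)) ((1 / N : ℂ) * ∑ i ∈ Finset.range N, g' (s i)) ≤ ε / 3 := by
    rw [dist_eq_norm, ← mul_sub, ← Finset.sum_sub_distrib, norm_mul]
    have h4 := norm_sum_le_of_le (Finset.range N) (fun i _ => hpt (s i))
    rw [Finset.sum_const, Finset.card_range, nsmul_eq_mul] at h4
    rcases Nat.eq_zero_or_pos N with rfl | hN
    · simp; positivity
    · have hN' : (0:ℝ) < N := by exact_mod_cast hN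
      rw [norm_div, norm_one, Complex.norm_natCast]
      calc _ ≤ 1 / (N:ℝ) * (N * (ε / 3)) := by gcongr
        _ = ε / 3 := by field_simp
  calc _ ≤ _ := dist_triangle4 _ ((1 / N : ℂ) * ∑ i ∈ Finset.range N, g' (s i)) (∫ x, g' x ∂ρ) _
    _ < ε := by linarith

lemma weyl_torus (μ : Measure UnitAddCircle) [IsProbabilityMeasure μ] (a b : ℕ → UnitAddCircle)
    (h : ∀ q l : ℤ, Tendsto (fun N : ℕ => (1 / N : ℂ) * ∑ i ∈ Finset.range N, fourier q (a i) * fourier l (b i)) atTop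
      (𝓝 ((∫ x : UnitAddCircle, fourier q x) * ∫ x, fourier l x ∂μ)))
    (f : C(UnitAddCircle × UnitAddCircle, ℝ)) :
    Tendsto (fun N : ℕ => (1 / N : ℝ) * ∑ i ∈ Finset.range N, f (a i, b i)) atTop
      (𝓝 (∫ q, f q ∂((volume : Measure UnitAddCircle).prod μ))) := by
  let e : UnitAddTorus (Fin 2) ≃ₜ UnitAddCircle × UnitAddCircle := Homeomorph.piFinTwo (fun _ => UnitAddCircle)
  have he : Measurable e.symm := e.symm.continuous.measurable
  let ρ : Measure (UnitAddTorus (Fin 2)) := ((volume : Measure UnitAddCircle).prod μ).map e.symm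
  have hvol : IsProbabilityMeasure (volume : Measure UnitAddCircle) := ⟨UnitAddCircle.measure_univ⟩
  have hρ : IsProbabilityMeasure ρ := Measure.isProbabilityMeasure_map he.aemeasurable
  let g : C(UnitAddTorus (Fin 2), ℂ) := ⟨fun x => (f (e x) : ℂ), by fun_prop⟩
  have hIntg : ∀ g : C(UnitAddTorus (Fin 2), ℂ), ∫ x, g x ∂ρ = ∫ z, g (e.symm z) ∂((volume : Measure UnitAddCircle).prod μ) :=
    fun g => integral_map he.aemeasurable g.continuous.aestronglyMeasurable
  have hw := weyl ρ (fun i => e.symm (a i, b i)) (range UnitAddTorus.mFourier)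
    UnitAddTorus.span_mFourier_closure_eq_top (by
      rintro _ ⟨n, rfl⟩
      have e1 : ∀ z : UnitAddCircle × UnitAddCircle, UnitAddTorus.mFourier n (e.symm z) =
          fourier (n 0) z.1 * fourier (n 1) z.2 := by
        intro z
        change ∏ i, fourier (n i) (e.symm z i) = _
        rw [Fin.prod_univ_two]; rfl
      rw [hIntg]
      simp_rw [e1]
      rw [integral_prod_mul]
      exact h _ _) g
  rw [hIntg] at hw
  have e2 : ∀ z, g (e.symm z) = (f z : ℂ) := fun z => by simp [g]
  simp_rw [e2] at hw
  rw [integral_complex_ofReal] at hw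
  have := (Complex.continuous_re.tendsto _).comp hw
  refine (this.congr fun N => ?_)
  simp only [Function.comp]
  rw [← Complex.ofReal_re ((1 / N : ℝ) * ∑ i ∈ Finset.range N, f (a i, b i))]
  push_cast; rfl

lemma integral_fourier_vol {q : ℤ} (hq : q ≠ 0) : ∫ x : UnitAddCircle, fourier q x = 0 :=
  integral_eq_zero_of_add_right_eq_neg (μ := (volume : Measure UnitAddCircle)) (fourier_add_half_inv_index hq one_pos)

lemma birkhoff_fourier {p : ℕ} {μ : Measure UnitAddCircle} [IsProbabilityMeasure μ]
    (herg : Ergodic (fun x : UnitAddCircle => p • x) μ) (l : ℤ) :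
    ∀ᵐ x ∂μ, Tendsto (fun N : ℕ => (1 / N : ℂ) * ∑ i ∈ Finset.range N,
      fourier l ((fun y : UnitAddCircle => p • y)^[i] x)) atTop (𝓝 (∫ x, fourier l x ∂μ)) := by
  have hc : Continuous (fun x : UnitAddCircle => (fourier l x : ℂ)) := (fourier l).continuous
  have hi : Integrable (fun x : UnitAddCircle => (fourier l x : ℂ)) μ :=
    Integrable.of_bound hc.aestronglyMeasurable 1 (Eventually.of_forall fun x => by rw [fourier_apply]; exact (Circle.norm_coe _).le)
  have h1 := birkhoff_ergodic herg (f := fun x => (fourier l x).re) (Complex.continuous_re.comp hc).measurable hi.re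
  have h2 := birkhoff_ergodic herg (f := fun x => (fourier l x).im) (Complex.continuous_im.comp hc).measurable hi.im
  filter_upwards [h1, h2] with x h1 h2
  have h3 := ((Complex.continuous_ofReal.tendsto _).comp h1).add
    (((Complex.continuous_ofReal.tendsto _).comp h2).mul_const Complex.I)
  have e := integral_re_add_im hi
  simp only [RCLike.re_eq_complex_re, RCLike.im_eq_complex_im, Complex.coe_algebraMap, RCLike.I_to_complex] at e
  rw [← e]
  refine h3.congr fun N => ?_
  simp only [Function.comp]
  push_cast
  rw [mul_assoc, ← mul_add, Finset.sum_mul, ← Finset.sum_add_distrib]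
  simp_rw [Complex.re_add_im]
end SEq

namespace SEq

/-- digits of a point of the circle -/
noncomputable def dig (p : ℕ) [NeZero p] (x : UnitAddCircle) : ℕ → Fin p := Real.digits (rep x) p

section
variable {p : ℕ} [NeZero p]

lemma measurable_digits : Measurable (fun x : ℝ => Real.digits x p) := by
  refine measurable_pi_lambda _ fun n => ?_
  unfold Real.digits
  exact (measurable_of_countable (fun k : ℕ => Fin.ofNat p k)).comp (Nat.measurable_floor.comp (measurable_id.mul_const _))

lemma measurable_dig : Measurable (dig p) := measurable_digits.comp measurable_rep

lemma val_dig (hp : 2 ≤ p) (x : UnitAddCircle) : Real.ofDigits (dig p x) = rep x :=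
  Real.ofDigits_digits (by omega) ⟨rep_nonneg x, rep_lt_one x⟩

lemma shift_dig (x : UnitAddCircle) : shift (dig p x) = dig p (p • x) := by
  have hx : rep (p • x) = Int.fract (p * rep x) := by
    rw [← rep_coe]
    congr 1
    conv_lhs => rw [← coe_rep x]
    rw [← nsmul_eq_mul]; rfl
  ext n
  simp only [shift, dig, Real.digits, hx]
  have hr := rep_nonneg x
  set r := rep x
  have e : Int.fract (p * r) * (p:ℝ) ^ (n + 1) = r * (p:ℝ) ^ (n + 1 + 1) - (⌊(p:ℝ) * r⌋₊ * p ^ (n + 1) : ℕ) := by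
    rw [Int.fract]
    push_cast
    rw [natCast_floor_eq_intCast_floor (by positivity)]
    ring
  rw [e, Nat.floor_sub_natCast]
  have hle : ⌊(p:ℝ) * r⌋₊ * p ^ (n + 1) ≤ ⌊r * (p:ℝ) ^ (n + 1 + 1)⌋₊ := by
    refine Nat.le_floor ?_
    push_cast
    have := Nat.floor_le (show 0 ≤ (p:ℝ) * r by positivity)
    calc (⌊(p:ℝ) * r⌋₊ : ℝ) * p ^ (n + 1) ≤ (p * r) * p ^ (n + 1) := by gcongr
      _ = _ := by ring
  simp only [Fin.ofNat]
  conv_lhs => rw [← Nat.sub_add_cancel hle]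
  rw [show ⌊(p:ℝ) * r⌋₊ * p ^ (n + 1) = ⌊(p:ℝ) * r⌋₊ * p ^ n * p by rw [pow_succ, mul_assoc], Nat.add_mul_mod_self_right]

lemma measurable_err (k : ℕ) (G : (Fin k → Fin p) → Fin p) (n : ℕ) : Measurable (err k G n) := by
  unfold err
  refine Finset.measurable_sum _ fun j _ => ?_
  refine Measurable.ite ?_ measurable_const measurable_const
  refine measurableSet_eq_fun (measurable_pi_apply _) ((measurable_of_countable G).comp ?_)
  exact measurable_pi_lambda _ fun i => measurable_pi_apply _

lemma measurableSet_errev (k : ℕ) (G : (Fin k → Fin p) → Fin p) (δ : ℝ) :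
    MeasurableSet {y : ℕ → Fin p | ∀ᶠ n : ℕ in atTop, (err k G n y : ℝ) ≤ δ * n} := by
  simp only [eventually_atTop]
  have : {y : ℕ → Fin p | ∃ a, ∀ n ≥ a, (err k G n y : ℝ) ≤ δ * n} =
      ⋃ a : ℕ, ⋂ n : ℕ, ⋂ (_ : n ≥ a), {y | (err k G n y : ℝ) ≤ δ * n} := by
    ext y; simp
  rw [this]
  refine MeasurableSet.iUnion fun a => MeasurableSet.iInter fun n => MeasurableSet.iInter fun _ => ?_
  exact measurableSet_le ((measurable_of_countable (fun n : ℕ => (n:ℝ))).comp (measurable_err k G n)) measurable_const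

lemma ee_fourier (q : ℤ) (x : UnitAddCircle) : (fourier q x : ℂ) = ee (q * rep x) := by
  conv_lhs => rw [← coe_rep x]
  rw [fourier_coe_apply, ee]
  congr 1; push_cast; ring

lemma fourier_nsmul (q : ℤ) (n : ℕ) (x : UnitAddCircle) : (fourier q (n • x) : ℂ) = ee (q * n * rep x) := by
  conv_lhs => rw [← coe_rep x]
  rw [← AddCircle.coe_nsmul, fourier_coe_apply, ee]
  congr 1; push_cast; simp; ring

lemma iterate_smul (n i : ℕ) (x : UnitAddCircle) : (fun y : UnitAddCircle => n • y)^[i] x = (n ^ i) • x := by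
  induction i with
  | zero => simp
  | succ i ih => rw [Function.iterate_succ_apply', ih, pow_succ', mul_smul]

lemma main_fourier {m : ℕ} (hp : 2 ≤ p) (hpm : p < m) (hirr : Irrational (Real.log m / Real.log p))
    (μ : Measure UnitAddCircle) [IsProbabilityMeasure μ]
    (hμ : MeasurePreserving (fun x : UnitAddCircle => p • x) μ μ)
    (hdim : 0 < measureDim μ) {q : ℤ} (hq : q ≠ 0) (l : ℤ) :
    ∀ᵐ x ∂μ, Tendsto (fun N : ℕ => (1 / N : ℂ) * ∑ i ∈ Finset.range N,
      fourier q ((fun y : UnitAddCircle => m • y)^[i] x) * fourier l ((fun y : UnitAddCircle => p • y)^[i] x)) atTop (𝓝 0) := by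
  set ν := μ.map (dig p) with hν
  have hνp : IsProbabilityMeasure ν := Measure.isProbabilityMeasure_map measurable_dig.aemeasurable
  have hshift : MeasurePreserving shift ν ν := by
    refine ⟨measurable_shift, ?_⟩
    have e : shift ∘ dig p = dig p ∘ (fun x : UnitAddCircle => p • x) := funext fun x => shift_dig x
    rw [hν, Measure.map_map measurable_shift measurable_dig, e, ← Measure.map_map measurable_dig hμ.measurable, hμ.map_eq]
  obtain ⟨P, hPp, hP, hPf⟩ := natExt ν hshift
  -- conditional nonatomicity
  obtain ⟨s', hs0, hs1⟩ := exists_between hdim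
  have hs'top : s' ≠ ⊤ := hs1.ne_top
  obtain ⟨δ, hδ, hδ'⟩ := dim_err hp (ENNReal.toReal_pos hs0.ne' hs'top)
  have hnull : ∀ k (G : (Fin k → Fin p) → Fin p),
      P (fut ⁻¹' {y | ∀ᶠ n : ℕ in atTop, (err k G n y : ℝ) ≤ δ * n}) = 0 := by
    intro k G
    have hY := measurableSet_errev k G δ
    rw [← Measure.map_apply measurable_fut hY, hPf, hν, Measure.map_apply measurable_dig hY]
    by_contra hne
    have h1 := hδ' k G
    rw [ENNReal.ofReal_toReal hs'top] at h1
    have h2 : dig p ⁻¹' {y | ∀ᶠ n : ℕ in atTop, (err k G n y : ℝ) ≤ δ * n} ⊆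
        cval '' {y | ∀ᶠ n : ℕ in atTop, (err k G n y : ℝ) ≤ δ * n} := by
      intro x hx
      refine ⟨dig p x, hx, ?_⟩
      rw [cval, val_dig hp, coe_rep]
    have h3 : measureDim μ ≤ dimH (dig p ⁻¹' {y | ∀ᶠ n : ℕ in atTop, (err k G n y : ℝ) ≤ δ * n}) :=
      iInf_le_of_le _ (iInf_le_of_le (measurable_dig hY) (iInf_le _ (pos_iff_ne_zero.2 hne)))
    exact absurd (h3.trans ((dimH_mono h2).trans h1)) (not_le.2 hs1)
  have hfm := nonatomic P hP hδ hnull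
  have hDf : ∀ᵐ ω ∂P, Real.digits (Real.ofDigits (fut ω)) p = fut ω := by
    have hmS : MeasurableSet {y : ℕ → Fin p | Real.digits (Real.ofDigits y) p = y} :=
      measurableSet_eq_fun (measurable_digits.comp Real.continuous_ofDigits.measurable) measurable_id
    have h1 : ∀ᵐ y ∂(P.map fut), y ∈ {y : ℕ → Fin p | Real.digits (Real.ofDigits y) p = y} := by
      rw [hPf, hν]
      refine (ae_map_iff measurable_dig.aemeasurable hmS).2 ?_
      refine Eventually.of_forall fun x => ?_
      change Real.digits (Real.ofDigits (dig p x)) p = dig p x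
      rw [val_dig hp]; rfl
    exact ae_of_ae_map measurable_fut.aemeasurable h1
  have hna := kap_noatom P measurable_digits hfm hDf
  have hz := z_tendsto P hp hpm hirr hP hna hq l
  -- transfer
  have hmT : MeasurableSet {y : ℕ → Fin p | Tendsto (fun N : ℕ => (1 / N : ℂ) * ∑ i ∈ Finset.range N,
      ee ((q * (m:ℝ) ^ i + l * (p:ℝ) ^ i) * Real.ofDigits y)) atTop (𝓝 0)} := by
    refine measurableSet_tendsto _ fun N => ?_
    refine (Finset.measurable_sum _ fun i _ => ?_).const_mul _
    exact measurable_eeval _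
  have h1 : ∀ᵐ y ∂(P.map fut), y ∈ {y : ℕ → Fin p | Tendsto (fun N : ℕ => (1 / N : ℂ) * ∑ i ∈ Finset.range N,
      ee ((q * (m:ℝ) ^ i + l * (p:ℝ) ^ i) * Real.ofDigits y)) atTop (𝓝 0)} :=
    (ae_map_iff measurable_fut.aemeasurable hmT).2 hz
  rw [hPf, hν] at h1
  replace h1 := (ae_map_iff measurable_dig.aemeasurable hmT).1 h1
  filter_upwards [h1] with x hx
  have hx : Tendsto (fun N : ℕ => (1 / N : ℂ) * ∑ i ∈ Finset.range N,
      ee ((q * (m:ℝ) ^ i + l * (p:ℝ) ^ i) * Real.ofDigits (dig p x))) atTop (𝓝 0) := hx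
  refine hx.congr fun N => ?_
  congr 1
  refine Finset.sum_congr rfl fun i _ => ?_
  rw [iterate_smul, iterate_smul, fourier_nsmul, fourier_nsmul, ← ee_add, val_dig hp]
  push_cast; congr 1; ring
end
end SEq


/-- Let `p ≥ 2` and let `μ` be a Borel probability measure on the circle
`𝕋 = ℝ/ℤ` which is invariant and ergodic under `T_p x = p • x` and has `dim μ > 0`.
Let `m > p` with `log p / log m` irrational.  Then for `μ`-a.e. `x`, the empirical measures
`(1/N) ∑_{i<N} δ_{(T_m^i x, T_p^i x)}` converge weak-* to `λ × μ` on `𝕋²`. -/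
theorem simultaneous_equidistribution_times_m_times_p
    (p m : ℕ) (hp : 2 ≤ p) (hpm : p < m)
    (hind : Irrational (Real.log p / Real.log m))
    (μ : Measure UnitAddCircle) [IsProbabilityMeasure μ]
    (herg : Ergodic (fun x : UnitAddCircle => p • x) μ)
    (hdim : 0 < measureDim μ) :
    ∀ᵐ x ∂μ, ∀ f : C(UnitAddCircle × UnitAddCircle, ℝ),
      Tendsto (fun N : ℕ => (1 / N : ℝ) * ∑ i ∈ Finset.range N,
          f ((fun y : UnitAddCircle => m • y)^[i] x, (fun y : UnitAddCircle => p • y)^[i] x))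
        atTop
        (𝓝 (∫ q, f q ∂((volume : Measure UnitAddCircle).prod μ))) := by
  have : NeZero p := ⟨by omega⟩
  have hirr : Irrational (Real.log m / Real.log p) := by
    have := hind.inv
    rwa [inv_div] at this
  have hall : ∀ᵐ x ∂μ, ∀ q l : ℤ, Tendsto (fun N : ℕ => (1 / N : ℂ) * ∑ i ∈ Finset.range N,
      fourier q ((fun y : UnitAddCircle => m • y)^[i] x) * fourier l ((fun y : UnitAddCircle => p • y)^[i] x)) atTop
      (𝓝 ((∫ x : UnitAddCircle, fourier q x) * ∫ x, fourier l x ∂μ)) := by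
    rw [ae_all_iff]; intro q
    rw [ae_all_iff]; intro l
    by_cases hq : q = 0
    · subst hq
      have h := SEq.birkhoff_fourier herg l
      have hvol : IsProbabilityMeasure (volume : Measure UnitAddCircle) := ⟨UnitAddCircle.measure_univ⟩
      simpa using h
    · rw [SEq.integral_fourier_vol hq, zero_mul]
      exact SEq.main_fourier hp hpm hirr μ herg.toMeasurePreserving hdim hq l
  filter_upwards [hall] with x hx f
  exact SEq.weyl_torus μ _ _ hx f
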